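/- arXiv:math/0411466 — 13 statements merged into one kernel-verified Lean document; each statement's English description precedes it below -/
import Mathlib

section
/- A group G is strongly bounded if and only if G is Cayley bounded and G has cofinality ≠ ω. -/
open scoped Pointwise

/-- A group `G` is strongly bounded if every action of `G` by isometries on a metric
space has all orbits bounded. -/
def StronglyBounded (G : Type) [Group G] : Prop :=
  ∀ (X : Type) [MetricSpace X] (φ : G →* (X ≃ᵢ X)) (x : X),
    Bornology.IsBounded (Set.range fun g : G => φ g x)

/-- A group `G` is Cayley bounded if for every generating subset `U` there is `n` such
that every element of `G` is a product of `n` elements of `U ∪ U⁻¹ ∪ {1}`. -/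
def CayleyBounded (G : Type) [Group G] : Prop :=
  ∀ U : Set G, Subgroup.closure U = ⊤ →
    ∃ n : ℕ, ∀ g : G, ∃ w : Fin n → G,
      (∀ i, w i ∈ U ∪ U⁻¹ ∪ {1}) ∧ g = (List.ofFn w).prod

/-- A group `G` has cofinality `ω` if it is the union of a strictly increasing sequence
of proper subgroups indexed by `ℕ`. -/
def CofinalityOmega (G : Type) [Group G] : Prop :=
  ∃ H : ℕ → Subgroup G, StrictMono H ∧ (∀ n, H n ≠ ⊤) ∧ (⋃ n, (H n : Set G)) = Set.univ

/-- A subadditive filtration of a strongly bounded group by symmetric subsets containing `1`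
is eventually everything. -/
theorem StronglyBounded.exists_eq_univ {G : Type} [Group G] (hG : StronglyBounded G)
    (A : ℕ → Set G) (hmono : Monotone A) (hone : 1 ∈ A 0)
    (hinv : ∀ n, ∀ g ∈ A n, g⁻¹ ∈ A n)
    (hmul : ∀ m n, ∀ g ∈ A m, ∀ h ∈ A n, g * h ∈ A (m + n))
    (hcover : ∀ g, ∃ n, g ∈ A n) : ∃ n, A n = Set.univ := by
  classical
  let L : G → ℕ := fun g => Nat.find (hcover g)
  have hL (g : G) : g ∈ A (L g) := Nat.find_spec (hcover g)
  have hLle {n : ℕ} {g : G} (h : g ∈ A n) : L g ≤ n := Nat.find_min' (hcover g) h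
  have hLinv (g : G) : L g⁻¹ ≤ L g := hLle (hinv _ _ (hL g))
  have hLmul (g h : G) : L (g * h) ≤ L g + L h := hLle (hmul _ _ _ (hL g) _ (hL h))
  let d : G → G → ℕ := fun g h => if g = h then 0 else L (g⁻¹ * h) + 1
  have hd_symm (g h : G) : d g h ≤ d h g := by
    have := hLinv (h⁻¹ * g)
    rw [mul_inv_rev, inv_inv] at this
    simp only [d, eq_comm (a := h)]
    split_ifs <;> omega
  have hd_triangle (a b c : G) : d a c ≤ d a b + d b c := by
    have := hLmul (a⁻¹ * b) (b⁻¹ * c)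
    rw [mul_assoc, mul_inv_cancel_left] at this
    by_cases hab : a = b
    · subst hab
      simp [d]
    by_cases hbc : b = c
    · subst hbc
      simp [d]
    simp only [d, if_neg hab, if_neg hbc]
    split_ifs <;> omega
  let _ : MetricSpace G :=
    { dist := fun g h => d g h
      dist_self := fun g => by simp [d]
      dist_comm := fun g h => by exact_mod_cast (hd_symm g h).antisymm (hd_symm h g)
      dist_triangle := fun a b c => by exact_mod_cast hd_triangle a b c
      eq_of_dist_eq_zero := fun {g h} hgh => by
        by_contra hne
        have : d g h = 0 := by exact_mod_cast hgh
        simp [d, hne] at this }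
  have hdist (g h : G) : dist g h = d g h := rfl
  let φ : G →* (G ≃ᵢ G) :=
    { toFun := fun g => IsometryEquiv.mk (Equiv.mulLeft g) <| Isometry.of_dist_eq fun a b => by
        simp [hdist, d]
      map_one' := by ext; simp
      map_mul' := fun g h => by ext; simp }
  obtain ⟨C, hC⟩ := Metric.isBounded_iff.1 (hG G φ 1)
  obtain ⟨n, hn⟩ := exists_nat_ge C
  refine ⟨n, Set.eq_univ_of_forall fun g => ?_⟩
  by_cases hg : 1 = g
  · exact hg ▸ hmono n.zero_le hone
  have hle : dist (φ 1 1) (φ g 1) ≤ n := (hC ⟨1, rfl⟩ ⟨g, rfl⟩).trans hn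
  have hφ (g : G) : φ g 1 = g := mul_one g
  rw [hφ, hφ, hdist, Nat.cast_le] at hle
  simp only [d, if_neg hg, inv_one, one_mul] at hle
  exact hmono (by omega) (hL g)

theorem StronglyBounded.cayleyBounded {G : Type} [Group G] (hG : StronglyBounded G) :
    CayleyBounded G := by
  intro U hU
  let S : Set G := U ∪ U⁻¹ ∪ {1}
  have hS1 : (1 : G) ∈ S := Or.inr rfl
  have hSinv : S⁻¹ = S := by simp [S, Set.union_comm]
  have hcover (g : G) : ∃ n, g ∈ S ^ n := by
    have hg : g ∈ Subgroup.closure U := hU ▸ Subgroup.mem_top g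
    induction hg using Subgroup.closure_induction with
    | mem x hx => exact ⟨1, (pow_one S).symm ▸ Or.inl (Or.inl hx)⟩
    | one => exact ⟨0, by simp⟩
    | mul x y _ _ hx hy =>
      obtain ⟨m, hm⟩ := hx
      obtain ⟨n, hn⟩ := hy
      exact ⟨m + n, pow_add S m n ▸ Set.mul_mem_mul hm hn⟩
    | inv x _ hx =>
      obtain ⟨n, hn⟩ := hx
      exact ⟨n, by rwa [← hSinv, inv_pow, Set.inv_mem_inv]⟩
  obtain ⟨n, hn⟩ := hG.exists_eq_univ (fun n => S ^ n)
    (fun _ _ h => Set.pow_subset_pow_right hS1 h) (by simp)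
    (fun n g hg => by
      rwa [← hSinv, inv_pow, Set.inv_mem_inv])
    (fun m n g hg h hh => pow_add S m n ▸ Set.mul_mem_mul hg hh) hcover
  refine ⟨n, fun g => ?_⟩
  obtain ⟨w, hw⟩ := Set.mem_pow.1 (hn ▸ Set.mem_univ g : g ∈ S ^ n)
  exact ⟨fun i => w i, fun i => (w i).2, hw.symm⟩

theorem StronglyBounded.not_cofinalityOmega {G : Type} [Group G] (hG : StronglyBounded G) :
    ¬ CofinalityOmega G := by
  rintro ⟨H, hH, hproper, hunion⟩
  obtain ⟨n, hn⟩ := hG.exists_eq_univ (fun n => (H n : Set G)) hH.monotone (H 0).one_mem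
    (fun n _ hg => (H n).inv_mem hg)
    (fun m n _ hg _ hh => (H (m + n)).mul_mem (hH.monotone (Nat.le_add_right m n) hg)
      (hH.monotone (Nat.le_add_left n m) hh))
    (fun g => Set.mem_iUnion.1 (hunion ▸ Set.mem_univ g))
  exact hproper n (SetLike.coe_injective (by simpa using hn))

/-- A monotone sequence of proper subgroups covering the group witnesses cofinality `ω`, even if
it is not strictly increasing. -/
theorem CofinalityOmega.of_monotone {G : Type} [Group G] (H : ℕ → Subgroup G) (hmono : Monotone H)
    (hproper : ∀ n, H n ≠ ⊤) (hcover : ∀ g, ∃ n, g ∈ H n) : CofinalityOmega G := by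
  have hlt (n : ℕ) : ∃ m, H n < H m := by
    obtain ⟨g, hg⟩ := SetLike.exists_not_mem_of_ne_top (H n) (hproper n)
    obtain ⟨m, hm⟩ := hcover g
    refine ⟨max n m, (hmono (le_max_left n m)).lt_of_not_ge fun h => hg (h ?_)⟩
    exact hmono (le_max_right n m) hm
  choose f hf using hlt
  have hstrict : StrictMono fun k => H (f^[k] 0) :=
    strictMono_nat_of_lt_succ fun k => by
      rw [Function.iterate_succ_apply']
      exact hf _
  have hindex : StrictMono fun k => f^[k] 0 :=
    strictMono_nat_of_lt_succ fun k => hmono.reflect_lt (hstrict k.lt_succ_self)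
  refine ⟨_, hstrict, fun _ => hproper _, Set.eq_univ_of_forall fun g => ?_⟩
  obtain ⟨n, hn⟩ := hcover g
  exact Set.mem_iUnion.2 ⟨n, hmono (hindex.le_apply (x := n)) hn⟩

theorem dist_list_prod_apply_le {G X : Type*} [Group G] [MetricSpace X] (φ : G →* (X ≃ᵢ X)) (x : X)
    (C : ℝ) (l : List G) (hl : ∀ g ∈ l, dist (φ g x) x ≤ C) :
    dist (φ l.prod x) x ≤ l.length * C := by
  induction l with
  | nil => simp
  | cons g l ih =>
    have hg := hl g List.mem_cons_self
    have hrest := ih fun a ha => hl a (List.mem_cons_of_mem _ ha)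
    have htri := dist_triangle (φ g (φ l.prod x)) (φ g x) x
    rw [(φ g).dist_eq] at htri
    rw [List.prod_cons, map_mul, IsometryEquiv.mul_apply, List.length_cons]
    push_cast
    linarith

theorem CayleyBounded.stronglyBounded {G : Type} [Group G] (hG : CayleyBounded G)
    (hcof : ¬ CofinalityOmega G) : StronglyBounded G := by
  intro X _ φ x
  let A : ℕ → Set G := fun n => {g | dist (φ g x) x ≤ n}
  have hA : Monotone A := fun m n hmn g (hg : dist (φ g x) x ≤ m) =>
    hg.trans (Nat.cast_le.2 hmn)
  obtain ⟨n, hn⟩ : ∃ n, Subgroup.closure (A n) = ⊤ := by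
    by_contra! hproper
    refine hcof (.of_monotone _ (fun _ _ h => Subgroup.closure_mono (hA h)) hproper fun g => ?_)
    obtain ⟨n, hn⟩ := exists_nat_ge (dist (φ g x) x)
    exact ⟨n, Subgroup.subset_closure hn⟩
  obtain ⟨k, hk⟩ := hG (A n) hn
  refine (Metric.isBounded_iff_subset_closedBall x).2 ⟨k * n, ?_⟩
  rintro _ ⟨g, rfl⟩
  obtain ⟨w, hw, rfl⟩ := hk g
  have := dist_list_prod_apply_le φ x n (List.ofFn w) fun g hg => by
    obtain ⟨i, rfl⟩ := List.mem_ofFn.1 hg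
    rcases hw i with (h | h) | h
    · exact h
    · have h' : dist (φ (w i)⁻¹ x) x ≤ n := h
      rw [← (φ (w i)).dist_eq, ← IsometryEquiv.mul_apply, ← map_mul] at h'
      simpa [dist_comm] using h'
    · simp [Set.mem_singleton_iff.1 h]
  simpa using this

theorem stronglyBounded_iff_cayleyBounded_and_not_cofinalityOmega
    (G : Type) [Group G] :
    StronglyBounded G ↔ CayleyBounded G ∧ ¬ CofinalityOmega G := by
  exact ⟨fun h => ⟨h.cayleyBounded, h.not_cofinalityOmega⟩, fun h => h.1.stronglyBounded h.2⟩
end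

section
/- Every countable strongly bounded group is finite; equivalently, no countably infinite group is strongly bounded. -/
open scoped Pointwise

/-- An exhaustion of a group with an enumeration `e`: each stage is the product set of the previous
stage with itself, enlarged by the elements enumerated next and their inverses. -/
def productExhaustion {G : Type*} [Group G] (e : G → ℕ) : ℕ → Set G
  | 0 => {1}
  | n + 1 => productExhaustion e n * productExhaustion e n ∪ ({g | e g = n} ∪ {g | e g⁻¹ = n})

namespace productExhaustion

variable {G : Type*} [Group G] (e : G → ℕ)

lemma one_mem (n : ℕ) : (1 : G) ∈ productExhaustion e n := by
  induction n with
  | zero => exact rfl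
  | succ n ih => exact Or.inl ⟨1, ih, 1, ih, one_mul 1⟩

lemma monotone : Monotone (productExhaustion e) :=
  monotone_nat_of_le_succ fun n g hg => Or.inl ⟨g, hg, 1, one_mem e n, mul_one g⟩

lemma inv_mem {n : ℕ} {g : G} (hg : g ∈ productExhaustion e n) :
    g⁻¹ ∈ productExhaustion e n := by
  induction n generalizing g with
  | zero =>
    rw [Set.mem_singleton_iff.mp hg, inv_one]
    exact rfl
  | succ n ih =>
    rcases hg with ⟨a, ha, b, hb, rfl⟩ | hg | hg
    · exact Or.inl ⟨b⁻¹, ih hb, a⁻¹, ih ha, (mul_inv_rev a b).symm⟩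
    · exact Or.inr (Or.inr (by simpa using hg))
    · exact Or.inr (Or.inl hg)

lemma finite (he : Function.Injective e) (n : ℕ) : (productExhaustion e n).Finite := by
  induction n with
  | zero => exact Set.finite_singleton 1
  | succ n ih =>
    refine (ih.mul ih).union (Set.Finite.union ?_ ?_)
    · exact (Set.finite_singleton n).preimage he.injOn
    · exact (Set.finite_singleton n).preimage (he.comp inv_injective).injOn

lemma exists_mem (g : G) : ∃ n, g ∈ productExhaustion e n :=
  ⟨e g + 1, Or.inr (Or.inl rfl)⟩

/-- The first stage of the exhaustion at which an element appears. -/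
noncomputable def level (g : G) : ℕ := sInf {n | g ∈ productExhaustion e n}

lemma mem_level (g : G) : g ∈ productExhaustion e (level e g) :=
  Nat.sInf_mem (exists_mem e g)

lemma level_le {n : ℕ} {g : G} (hg : g ∈ productExhaustion e n) : level e g ≤ n :=
  Nat.sInf_le hg

lemma level_inv (g : G) : level e g⁻¹ = level e g :=
  le_antisymm (level_le e (inv_mem e (mem_level e g)))
    (level_le e (by simpa using inv_mem e (mem_level e g⁻¹)))

lemma level_mul_le (g h : G) : level e (g * h) ≤ max (level e g) (level e h) + 1 :=
  level_le e (Or.inl ⟨g, monotone e (le_max_left _ _) (mem_level e g),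
    h, monotone e (le_max_right _ _) (mem_level e h), rfl⟩)

open Classical in
/-- The left-invariant metric on a group whose balls are governed by the exhaustion. -/
@[reducible] noncomputable def metricSpace : MetricSpace G where
  dist g h := if g = h then 0 else (level e (g⁻¹ * h) : ℝ) + 1
  dist_self g := if_pos rfl
  dist_comm g h := by
    rw [← level_inv e (g⁻¹ * h)]
    simp [eq_comm]
  dist_triangle g h k := by
    rcases eq_or_ne g h with rfl | hgh
    · simp
    rcases eq_or_ne h k with rfl | hhk
    · simp
    have hle : (level e (g⁻¹ * k) : ℝ) ≤ level e (g⁻¹ * h) + level e (h⁻¹ * k) + 1 := by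
      have := level_mul_le e (g⁻¹ * h) (h⁻¹ * k)
      rw [mul_assoc, mul_inv_cancel_left] at this
      exact_mod_cast this.trans (by omega)
    rw [if_neg hgh, if_neg hhk]
    split_ifs
    · positivity
    · linarith
  eq_of_dist_eq_zero {g h} hd := by
    by_contra hgh
    rw [if_neg hgh] at hd
    have : (0 : ℝ) < level e (g⁻¹ * h) + 1 := by positivity
    exact this.ne' hd

lemma isometry_mul_left (g : G) :
    @Isometry G G (metricSpace e).toPseudoEMetricSpace (metricSpace e).toPseudoEMetricSpace
      (g * ·) := by
  let _ := metricSpace e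
  refine Isometry.of_dist_eq fun a b => ?_
  by_cases hab : a = b <;> simp [dist, hab, mul_assoc]

lemma level_le_dist_one (g : G) : (level e g : ℝ) ≤ (metricSpace e).dist g 1 := by
  rcases eq_or_ne g 1 with rfl | hg
  · have : level e (1 : G) = 0 := Nat.le_zero.mp (level_le e (one_mem e 0))
    simp [dist, this]
  · simp [dist, hg, level_inv]

end productExhaustion

/-- Every countable strongly bounded group is finite; equivalently, no countably
infinite group is strongly bounded. -/
theorem finite_of_countable_stronglyBounded (G : Type) [Group G] [Countable G]
    (h : StronglyBounded G) : Finite G := by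
  obtain ⟨e, he⟩ := exists_injective_nat G
  let _ := productExhaustion.metricSpace e
  let φ : G →* (G ≃ᵢ G) :=
    { toFun := fun g => ⟨Equiv.mulLeft g, productExhaustion.isometry_mul_left e g⟩
      map_one' := IsometryEquiv.ext one_mul
      map_mul' := fun a b => IsometryEquiv.ext fun x => mul_assoc a b x }
  obtain ⟨r, hr⟩ := (h G φ 1).subset_closedBall 1
  refine Set.finite_univ_iff.mp ((productExhaustion.finite e he ⌊r⌋₊).subset fun g _ => ?_)
  have hg : dist g 1 ≤ r := mul_one g ▸ hr (Set.mem_range_self g)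
  exact productExhaustion.monotone e
    (Nat.le_floor ((productExhaustion.level_le_dist_one e g).trans hg))
    (productExhaustion.mem_level e g)
end

section
/- A group G is strongly bounded if and only if for every increasing sequence (Xₙ)ₙ∈ℕ of subsets of G with ⋃ₙ Xₙ = G and 𝒢(Xₙ) ⊆ Xₙ₊₁ for all n, one has Xₙ = G for some n. -/
open scoped Pointwise

/-- For a subset `X` of a group, `GSet X = X ∪ {1} ∪ X⁻¹ ∪ {xy : x, y ∈ X}`. -/
def GSet {G : Type} [Group G] (X : Set G) : Set G :=
  X ∪ {1} ∪ X⁻¹ ∪ X * X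

/-- The elements of a group that are products of members of the sets `X k` and of their
inverses, where each factor taken from `X k` costs `k + 1` and the total cost is `n`. -/
inductive HasCost {G : Type} [Group G] (X : ℕ → Set G) : ℕ → G → Prop
  | one : HasCost X 0 1
  | of_mem {n : ℕ} {g : G} (h : g ∈ X n) : HasCost X (n + 1) g
  | of_inv_mem {n : ℕ} {g : G} (h : g⁻¹ ∈ X n) : HasCost X (n + 1) g
  | mul {m n : ℕ} {g h : G} : HasCost X m g → HasCost X n h → HasCost X (m + n) (g * h)

section Length

variable {G : Type} [Group G] {X : ℕ → Set G}

lemma HasCost.inv {n : ℕ} {g : G} (h : HasCost X n g) : HasCost X n g⁻¹ := by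
  induction h with
  | one => simpa using HasCost.one
  | of_mem h => exact .of_inv_mem (by simpa using h)
  | of_inv_mem h => exact .of_mem h
  | mul _ _ ihg ihh => rw [mul_inv_rev, add_comm]; exact ihh.mul ihg

lemma HasCost.eq_one_or_mem (hmono : Monotone X) (hX : ∀ n, GSet (X n) ⊆ X (n + 1))
    {n : ℕ} {g : G} (h : HasCost X n g) :
    n = 0 ∧ g = 1 ∨ 1 ≤ n ∧ g ∈ X (2 * n - 1) := by
  induction h with
  | one => exact .inl ⟨rfl, rfl⟩
  | of_mem h => exact .inr ⟨by omega, hmono (by omega) h⟩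
  | @of_inv_mem n _ h =>
    exact .inr ⟨by omega, hmono (by omega) (hX n (.inl (.inr h)))⟩
  | @mul m n g h _ _ ihg ihh =>
    rcases ihg with ⟨rfl, rfl⟩ | ⟨hm, hg⟩
    · simpa using ihh
    rcases ihh with ⟨rfl, rfl⟩ | ⟨hn, hh⟩
    · exact .inr (by simpa using ⟨hm, hg⟩)
    refine .inr ⟨by omega, ?_⟩
    refine hmono (by omega) (hX (2 * max m n - 1) (.inr (Set.mul_mem_mul ?_ ?_)))
    · exact hmono (by omega) hg
    · exact hmono (by omega) hh

/-- The least cost of an element, in the sense of `HasCost`. -/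
noncomputable def costLength (X : ℕ → Set G) (g : G) : ℕ := sInf {n | HasCost X n g}

lemma costLength_le {n : ℕ} {g : G} (h : HasCost X n g) : costLength X g ≤ n := Nat.sInf_le h

lemma hasCost_costLength (hU : ⋃ n, X n = Set.univ) (g : G) :
    HasCost X (costLength X g) g := by
  obtain ⟨n, hn⟩ := Set.mem_iUnion.1 (hU ▸ Set.mem_univ g)
  exact Nat.sInf_mem (s := {n | HasCost X n g}) ⟨n + 1, .of_mem hn⟩

/-- The left-invariant metric on `G` given by `costLength X`. -/
noncomputable abbrev costMetric (hmono : Monotone X) (hU : ⋃ n, X n = Set.univ)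
    (hX : ∀ n, GSet (X n) ⊆ X (n + 1)) : MetricSpace G where
  dist g h := costLength X (g⁻¹ * h)
  dist_self g := by
    have := costLength_le (HasCost.one (X := X))
    simpa using this
  dist_comm g h := by
    have key (a b : G) : costLength X (a⁻¹ * b) ≤ costLength X (b⁻¹ * a) :=
      costLength_le (by simpa using (hasCost_costLength hU (b⁻¹ * a)).inv)
    exact congrArg Nat.cast (le_antisymm (key g h) (key h g))
  dist_triangle a b c := by
    have := (hasCost_costLength hU (a⁻¹ * b)).mul (hasCost_costLength hU (b⁻¹ * c))
    rw [mul_assoc, mul_inv_cancel_left] at this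
    exact_mod_cast costLength_le this
  eq_of_dist_eq_zero {g h} h0 := by
    have h0 : costLength X (g⁻¹ * h) = 0 := by exact_mod_cast h0
    rcases (hasCost_costLength hU (g⁻¹ * h)).eq_one_or_mem hmono hX with ⟨-, h1⟩ | ⟨h1, -⟩
    · exact inv_mul_eq_one.1 h1
    · omega

end Length

lemma StronglyBounded.exists_eq_univ_s2 {G : Type} [Group G] (hG : StronglyBounded G)
    {X : ℕ → Set G} (hmono : Monotone X) (hU : ⋃ n, X n = Set.univ)
    (hX : ∀ n, GSet (X n) ⊆ X (n + 1)) : ∃ n, X n = Set.univ := by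
  let := costMetric hmono hU hX
  let φ : G →* (G ≃ᵢ G) :=
    { toFun g := ⟨Equiv.mulLeft g, Isometry.of_dist_eq fun a b => by
        change (costLength X ((g * a)⁻¹ * (g * b)) : ℝ) = costLength X (a⁻¹ * b)
        congr 2
        group⟩
      map_one' := by ext; exact one_mul _
      map_mul' g h := by ext; exact mul_assoc _ _ _ }
  obtain ⟨r, hr⟩ := (Metric.isBounded_iff_subset_closedBall (1 : G)).1 (hG G φ 1)
  obtain ⟨N, hN⟩ := exists_nat_ge r
  refine ⟨2 * N + 1, Set.eq_univ_of_forall fun g => ?_⟩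
  have hg : dist (1 : G) g ≤ r := by
    have : dist (g * 1) 1 ≤ r := hr ⟨g, rfl⟩
    rwa [mul_one, dist_comm] at this
  have hg : costLength X ((1 : G)⁻¹ * g) ≤ N := Nat.cast_le.1 (hg.trans hN)
  rw [inv_one, one_mul] at hg
  rcases (hasCost_costLength hU g).eq_one_or_mem hmono hX with ⟨-, rfl⟩ | ⟨-, h⟩
  · exact hmono (by omega) (hX 0 (.inl (.inl (.inr rfl))))
  · exact hmono (by omega) h

lemma stronglyBounded_of_exhaustion {G : Type} [Group G]
    (h : ∀ X : ℕ → Set G, Monotone X → (⋃ n, X n) = Set.univ →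
      (∀ n, GSet (X n) ⊆ X (n + 1)) → ∃ n, X n = Set.univ) : StronglyBounded G := by
  intro Y _ φ x
  have hpow (n : ℕ) : (2 : ℝ) ^ n ≤ 2 ^ (n + 1) := pow_le_pow_right₀ one_le_two n.le_succ
  obtain ⟨n, hn⟩ := h (fun n => {g | dist (φ g x) x ≤ 2 ^ n})
    (monotone_nat_of_le_succ fun n g hg => le_trans hg (hpow n))
    (Set.eq_univ_of_forall fun g => by
      obtain ⟨n, hn⟩ := pow_unbounded_of_one_lt (dist (φ g x) x) one_lt_two
      exact Set.mem_iUnion.2 ⟨n, hn.le⟩)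
    (by
      rintro n _ (((hg | rfl) | hg) | ⟨g, hg, k, hk, rfl⟩)
      · exact le_trans hg (hpow n)
      · simp
      · rename_i g
        refine le_trans ?_ (hpow n)
        have hg : dist (φ g⁻¹ x) x ≤ 2 ^ n := hg
        rw [← (φ g).isometry.dist_eq, ← IsometryEquiv.mul_apply, ← map_mul] at hg
        simpa [dist_comm] using hg
      · have hg : dist (φ g x) x ≤ 2 ^ n := hg
        have hk : dist (φ k x) x ≤ 2 ^ n := hk
        change dist (φ (g * k) x) x ≤ 2 ^ (n + 1)
        rw [map_mul, IsometryEquiv.mul_apply]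
        have := dist_triangle (φ g (φ k x)) (φ g x) x
        rw [(φ g).isometry.dist_eq] at this
        rw [pow_succ]
        linarith)
  refine (Metric.isBounded_iff_subset_closedBall x).2 ⟨2 ^ n, ?_⟩
  rintro _ ⟨g, rfl⟩
  exact Set.eq_univ_iff_forall.1 hn g

theorem stronglyBounded_iff_exhaustion (G : Type) [Group G] :
    StronglyBounded G ↔
      ∀ X : ℕ → Set G, Monotone X → (⋃ n, X n) = Set.univ →
        (∀ n, GSet (X n) ⊆ X (n + 1)) → ∃ n, X n = Set.univ :=
  ⟨fun hG _ hmono hU hX => hG.exists_eq_univ_s2 hmono hU hX, stronglyBounded_of_exhaustion⟩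
end

section
/- Let G be a finite perfect group and I any set. Then the unrestricted direct power G^I (the group of all functions I → G under pointwise multiplication) is strongly bounded. -/
/-- A real function on the subsets of `I` that is subadditive under disjoint unions and
proper differences, and controlled on intersections, is bounded. -/
theorem Set.exists_le_of_subadditive {I : Type*} (M : Set I → ℝ) (C : ℝ) (hC : 0 ≤ C)
    (hunion : ∀ A B, Disjoint A B → M (A ∪ B) ≤ M A + M B)
    (hdiff : ∀ A B, B ⊆ A → M (A \ B) ≤ M A + M B)
    (hinter : ∀ A B, M (A ∩ B) ≤ C * (M A + M B)) :
    ∃ K, ∀ A, M A ≤ K := by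
  let Bad : Set I → Prop := fun A => ∀ K, ∃ B ⊆ A, K < M B
  have split : ∀ A B, Bad A → B ⊆ A → Bad B ∨ Bad (A \ B) := by
    intro A B hA hBA
    by_contra! h
    simp only [Bad, not_forall, not_exists, not_and, not_lt] at h
    obtain ⟨⟨K₁, h₁⟩, K₂, h₂⟩ := h
    obtain ⟨D, hDA, hD⟩ := hA (K₁ + K₂)
    have h := hunion (D ∩ B) (D \ B) (Set.disjoint_sdiff_right.mono_left Set.inter_subset_right)
    rw [Set.inter_union_sdiff] at h
    linarith [h₁ _ (Set.inter_subset_right (s := D)), h₂ _ (Set.sdiff_subset_sdiff_left hDA)]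
  have step : ∀ (n : ℕ) (A : {A // Bad A}), ∃ A' : {A // Bad A},
      A'.1 ⊆ A.1 ∧ (n : ℝ) ≤ M (A.1 \ A'.1) := by
    rintro n ⟨A, hA⟩
    obtain ⟨B, hBA, hB⟩ := hA (max n (n + M A))
    have h₁ : (n : ℝ) < M B := (le_max_left _ _).trans_lt hB
    have h₂ : n + M A < M B := (le_max_right _ _).trans_lt hB
    have h₃ := hdiff A (A \ B) Set.sdiff_subset
    rcases split A B hA hBA with h | h
    · refine ⟨⟨B, h⟩, hBA, ?_⟩
      rw [Set.sdiff_sdiff_cancel_left hBA] at h₃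
      dsimp only
      linarith
    · refine ⟨⟨A \ B, h⟩, Set.sdiff_subset, ?_⟩
      dsimp only
      rw [Set.sdiff_sdiff_cancel_left hBA]
      exact h₁.le
  by_contra! hM
  have huniv : Bad Set.univ := fun K => (hM K).imp fun B hB => ⟨Set.subset_univ _, hB⟩
  choose next hnext_sub hnext using step
  let E : ℕ → {A // Bad A} := fun n => Nat.rec ⟨Set.univ, huniv⟩ next n
  have hE : Antitone fun n => (E n).1 := antitone_nat_of_succ_le fun n => hnext_sub n (E n)
  let B : ℕ → Set I := fun n => (E n).1 \ (E (n + 1)).1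
  have hB : ∀ n : ℕ, (n : ℝ) ≤ M (B n) := fun n => hnext n (E n)
  have hBdisj : ∀ m n x, x ∈ B m → x ∈ B n → m = n := by
    intro m n x hm hn
    rcases lt_trichotomy m n with h | h | h
    · exact absurd (hE (Nat.succ_le_of_lt h) hn.1) hm.2
    · exact h
    · exact absurd (hE (Nat.succ_le_of_lt h) hm.1) hn.2
  let A : ℕ → Set I := fun k => ⋃ m, B (Nat.pair k m)
  have hA : ∀ k, Bad (A k) := by
    intro k K
    obtain ⟨m, hm⟩ := exists_nat_gt K
    refine ⟨B (Nat.pair k m), Set.subset_iUnion (fun m => B (Nat.pair k m)) m,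
      hm.trans_le (le_trans ?_ (hB _))⟩
    exact_mod_cast Nat.right_le_pair k m
  choose D hDA hD using fun k : ℕ => hA k (C * (k + M (A k)))
  have hinterD : ∀ k, (⋃ j, D j) ∩ A k = D k := by
    intro k
    refine subset_antisymm ?_ fun x hx => ⟨Set.mem_iUnion.2 ⟨k, hx⟩, hDA k hx⟩
    rintro x ⟨hx, hxk⟩
    obtain ⟨j, hj⟩ := Set.mem_iUnion.1 hx
    obtain ⟨a, ha⟩ := Set.mem_iUnion.1 (hDA j hj)
    obtain ⟨b, hb⟩ := Set.mem_iUnion.1 hxk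
    obtain ⟨rfl, -⟩ := Nat.pair_eq_pair.1 (hBdisj _ _ x ha hb)
    exact hj
  obtain ⟨k, hk⟩ := exists_nat_gt (M (⋃ j, D j))
  have h := hinter (⋃ j, D j) (A k)
  rw [hinterD] at h
  exact absurd (h.trans (by gcongr)) (hD k).not_ge

/-- A function on `I → G` that is bounded on the indicator functions of elements of the finite
group `G` and is subadditive is bounded. -/
theorem Pi.exists_le_of_mulIndicator_le {G I : Type*} [Group G] [Finite G]
    (L : (I → G) → ℝ) (hmul : ∀ f g, L (f * g) ≤ L f + L g) {K : ℝ}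
    (hK : ∀ (g : G) (A : Set I), L (A.mulIndicator fun _ => g) ≤ K) :
    ∃ R, ∀ f, L f ≤ R := by
  classical
  have := Fintype.ofFinite G
  suffices ∀ s : Finset G, ∃ R, ∀ f : I → G, (∀ i, f i = 1 ∨ f i ∈ s) → L f ≤ R by
    obtain ⟨R, hR⟩ := this Finset.univ
    exact ⟨R, fun f => hR f fun i => Or.inr (Finset.mem_univ _)⟩
  intro s
  induction s using Finset.induction_on with
  | empty =>
    refine ⟨K, fun f hf => ?_⟩
    have h : f = (∅ : Set I).mulIndicator fun _ => (1 : G) := by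
      funext i
      simpa using hf i
    exact h ▸ hK 1 ∅
  | insert g s _ ih =>
    obtain ⟨R, hR⟩ := ih
    refine ⟨K + R, fun f hf => ?_⟩
    rw [← Set.mulIndicator_self_mul_compl (f ⁻¹' {g}) f]
    refine (hmul _ _).trans (add_le_add ?_ (hR _ fun i => ?_))
    · rw [Set.mulIndicator_congr (s := f ⁻¹' {g}) (g := fun _ => g) fun i hi => hi]
      exact hK g _
    · by_cases hi : f i = g
      · simp [hi]
      · simpa [hi] using hf i

theorem Set.mulIndicator_inter_commutator {G I : Type*} [Group G] (A B : Set I) (g h : G) :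
    ((A ∩ B).mulIndicator fun _ => g * h * g⁻¹ * h⁻¹) =
      A.mulIndicator (fun _ => g) * B.mulIndicator (fun _ => h) *
        (A.mulIndicator fun _ => g)⁻¹ * (B.mulIndicator fun _ => h)⁻¹ := by
  classical
  funext i
  by_cases hA : i ∈ A <;> by_cases hB : i ∈ B <;> simp [hA, hB]

/-- A length function on a power of a finite perfect group is bounded. -/
theorem Pi.exists_le_of_length {G I : Type*} [Group G] [Finite G] (hperf : commutator G = ⊤)
    (L : (I → G) → ℝ) (hnonneg : ∀ f, 0 ≤ L f) (hone : L 1 = 0) (hinv : ∀ f, L f⁻¹ = L f)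
    (hmul : ∀ f g, L (f * g) ≤ L f + L g) : ∃ R, ∀ f, L f ≤ R := by
  have := Fintype.ofFinite G
  let M : Set I → ℝ := fun A => ∑ g : G, L (A.mulIndicator fun _ => g)
  have hM : ∀ g A, L (Set.mulIndicator A fun _ => g) ≤ M A := fun g A =>
    Finset.single_le_sum (f := fun g : G => L (A.mulIndicator fun _ => g))
      (fun _ _ => hnonneg _) (Finset.mem_univ g)
  have key : ∀ g : G, ∃ C : ℝ, 0 ≤ C ∧
      ∀ A B, L ((A ∩ B).mulIndicator fun _ => g) ≤ C * (M A + M B) := by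
    intro g
    have hg : g ∈ Subgroup.closure (commutatorSet G) := by
      rw [← commutator_eq_closure, hperf]
      trivial
    induction hg using Subgroup.closure_induction with
    | mem x hx =>
      obtain ⟨a, b, rfl⟩ := hx
      refine ⟨2, by norm_num, fun A B => ?_⟩
      rw [commutatorElement_def, Set.mulIndicator_inter_commutator]
      refine (hmul _ _).trans ?_
      grw [hmul, hmul, hinv, hinv, hM a A, hM b B]
      linarith
    | one =>
      refine ⟨0, le_rfl, fun A B => ?_⟩
      rw [Set.mulIndicator_one, zero_mul]
      exact hone.le
    | mul x y _ _ hx hy =>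
      obtain ⟨C, hC, h⟩ := hx
      obtain ⟨C', hC', h'⟩ := hy
      refine ⟨C + C', add_nonneg hC hC', fun A B => ?_⟩
      have := Set.mulIndicator_mul' (A ∩ B) (fun _ : I => x) fun _ => y
      rw [add_mul]
      exact (congrArg L this).trans_le ((hmul _ _).trans (add_le_add (h A B) (h' A B)))
    | inv x _ hx =>
      obtain ⟨C, hC, h⟩ := hx
      refine ⟨C, hC, fun A B => ?_⟩
      have := Set.mulIndicator_inv' (A ∩ B) fun _ : I => x
      exact (congrArg L this).trans_le ((hinv _).trans_le (h A B))
  choose C hC hinter using key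
  obtain ⟨K, hK⟩ := Set.exists_le_of_subadditive M (∑ g, C g)
    (Finset.sum_nonneg fun g _ => hC g)
    (fun A B hAB => by
      simp only [M, ← Finset.sum_add_distrib]
      refine Finset.sum_le_sum fun g _ => ?_
      rw [Set.mulIndicator_union_of_disjoint hAB]
      exact hmul _ _)
    (fun A B hBA => by
      simp only [M, ← Finset.sum_add_distrib]
      refine Finset.sum_le_sum fun g _ => ?_
      rw [Set.mulIndicator_sdiff hBA, ← hinv (B.mulIndicator _)]
      exact hmul _ _)
    (fun A B => by
      rw [Finset.sum_mul]
      exact Finset.sum_le_sum fun g _ => hinter g A B)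
  exact Pi.exists_le_of_mulIndicator_le L hmul fun g A => (hM g A).trans (hK A)

/-- If `G` is a finite perfect group and `I` is any set, then the unrestricted power
`G^I` is strongly bounded. -/
theorem stronglyBounded_pi_of_finite_perfect (G : Type) [Group G] [Finite G]
    (hperf : commutator G = ⊤) (I : Type) : StronglyBounded (I → G) := by
  intro X _ φ x
  obtain ⟨R, hR⟩ := Pi.exists_le_of_length hperf (fun f : I → G => dist (φ f x) x)
    (fun _ => dist_nonneg) (by simp)
    (fun f => by
      have h := (φ f).dist_eq (φ f⁻¹ x) x
      rw [← IsometryEquiv.mul_apply, ← map_mul, mul_inv_cancel, map_one,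
        IsometryEquiv.coe_one, id] at h
      rw [← h, dist_comm])
    (fun f g => by
      rw [map_mul, IsometryEquiv.mul_apply]
      have h := dist_triangle (φ f (φ g x)) (φ f x) x
      rw [(φ f).dist_eq] at h
      linarith)
  refine (Metric.isBounded_closedBall (x := x) (r := R)).subset ?_
  rintro _ ⟨f, rfl⟩
  exact hR f
end

section
/- Let G be a finite group which is not perfect and let I be an infinite set. Then the unrestricted direct power G^I has cofinality ω and is not Cayley bounded; in particular G^I is not strongly bounded. -/
open scoped Pointwise

/-- A finite group which is not perfect surjects onto a cyclic group of prime order. -/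
theorem exists_surjective_zmod_of_commutator_ne_top (G : Type) [Group G] [Finite G]
    (hnp : commutator G ≠ ⊤) :
    ∃ p : ℕ, p.Prime ∧ ∃ q : G →* Multiplicative (ZMod p), Function.Surjective q := by
  obtain ⟨N, hN, hle⟩ := (eq_top_or_exists_le_coatom (commutator G)).resolve_left hnp
  have hNn : N.Normal := Subgroup.Normal.of_commutator_le _ hle
  have hcomm : IsMulCommutative (G ⧸ N) :=
    Subgroup.Normal.quotient_commutative_iff_commutator_le.mpr hle
  have hnt : Nontrivial (G ⧸ N) := QuotientGroup.nontrivial_iff.mpr hN.1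
  have hsimple : IsSimpleGroup (G ⧸ N) := by
    refine ⟨fun H _ => ?_⟩
    have hNH : N ≤ H.comap (QuotientGroup.mk' N) := QuotientGroup.le_comap_mk' N H
    have hsurj := QuotientGroup.mk'_surjective N
    rcases hNH.eq_or_lt with h | h
    · left
      rw [← Subgroup.map_comap_eq_self_of_surjective hsurj H, ← h, QuotientGroup.map_mk'_self]
    · right
      rw [← Subgroup.map_comap_eq_self_of_surjective hsurj H, hN.2 _ h,
        Subgroup.map_top_of_surjective _ hsurj]
  let _ : CommGroup (G ⧸ N) := { mul_comm := hcomm.is_comm.comm }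
  have hcyc : IsCyclic (G ⧸ N) := IsSimpleGroup.isCyclic
  refine ⟨Nat.card (G ⧸ N), IsSimpleGroup.prime_card,
    (zmodCyclicMulEquiv hcyc).symm.toMonoidHom.comp (QuotientGroup.mk' N), ?_⟩
  exact (zmodCyclicMulEquiv hcyc).symm.surjective.comp (QuotientGroup.mk'_surjective N)

/-- An infinite power of a field surjects linearly onto a vector space of countable dimension. -/
theorem exists_surjective_pi_finsupp (K : Type) [Field K] (I : Type) [Infinite I] :
    ∃ r : (I → K) →ₗ[K] (ℕ →₀ K), Function.Surjective r := by
  let e : ℕ ↪ I := Infinite.natEmbedding I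
  let j : (ℕ →₀ K) →ₗ[K] (I → K) := Finsupp.lcoeFun ∘ₗ Finsupp.lmapDomain K K e
  have hj : Function.Injective j :=
    DFunLike.coe_injective.comp (Finsupp.mapDomain_injective e.injective)
  obtain ⟨r, hr⟩ := j.exists_leftInverse_of_injective (LinearMap.ker_eq_bot_of_injective hj)
  exact ⟨r, fun v => ⟨j v, LinearMap.congr_fun hr v⟩⟩

theorem exists_surjective_pi_multiplicative_finsupp (G : Type) [Group G] [Finite G]
    (hnp : commutator G ≠ ⊤) (I : Type) [Infinite I] :
    ∃ p : ℕ, p.Prime ∧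
      ∃ f : (I → G) →* Multiplicative (ℕ →₀ ZMod p), Function.Surjective f := by
  obtain ⟨p, hp, q, hq⟩ := exists_surjective_zmod_of_commutator_ne_top G hnp
  have : Fact p.Prime := ⟨hp⟩
  obtain ⟨r, hr⟩ := exists_surjective_pi_finsupp (ZMod p) I
  refine ⟨p, hp,
    { toFun := fun g => Multiplicative.ofAdd (r fun i => (q (g i)).toAdd)
      map_one' := ?_
      map_mul' := ?_ }, ?_⟩
  · have : (fun i => (q ((1 : I → G) i)).toAdd) = (0 : I → ZMod p) := by ext i; simp
    rw [this, map_zero, ofAdd_zero]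
  · intro g h
    rw [← ofAdd_add, ← map_add]
    congr 2
    ext i
    simp
  · intro v
    obtain ⟨x, hx⟩ := hr v.toAdd
    choose g hg using fun i => hq (Multiplicative.ofAdd (x i))
    refine ⟨g, ?_⟩
    simp [hg, hx]

theorem Finsupp.card_support_add_le {A : Type} [AddCommGroup A]
    (u v : ℕ →₀ A) :
    (u + v).support.card ≤ u.support.card + v.support.card := by
  classical
  exact (Finset.card_le_card Finsupp.support_add).trans (Finset.card_union_le _ _)

/-- The Hamming distance on finitely supported functions. -/
@[reducible] noncomputable def finsuppHammingMetric (A : Type) [AddCommGroup A] : MetricSpace (ℕ →₀ A) where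
  dist u v := ((u - v).support.card : ℝ)
  dist_self u := by simp
  dist_comm u v := by rw [← neg_sub u v, Finsupp.support_neg]
  dist_triangle u v w := by
    have := Finsupp.card_support_add_le (u - v) (v - w)
    rw [sub_add_sub_cancel] at this
    exact_mod_cast this
  eq_of_dist_eq_zero {u v} h := by
    simpa [sub_eq_zero] using h

section Quotient

variable {Γ A : Type} [Group Γ] [AddCommGroup A] [Nontrivial A]
  (f : Γ →* Multiplicative (ℕ →₀ A))

theorem cofinalityOmega_of_surjective_finsupp (hf : Function.Surjective f) :
    CofinalityOmega Γ := by
  obtain ⟨a, ha⟩ := exists_ne (0 : A)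
  let S (n : ℕ) : Subgroup Γ :=
    { carrier := {g | ∀ k, n ≤ k → (f g).toAdd k = 0}
      one_mem' := by simp
      mul_mem' := by
        intro x y hx hy k hk
        simp [hx k hk, hy k hk]
      inv_mem' := by
        intro x hx k hk
        simp [hx k hk] }
  have hmem (n : ℕ) (g : Γ) : g ∈ S n ↔ ∀ k, n ≤ k → (f g).toAdd k = 0 := Iff.rfl
  have hsep (n : ℕ) : ∃ g, g ∈ S (n + 1) ∧ g ∉ S n := by
    obtain ⟨g, hg⟩ := hf (Multiplicative.ofAdd (Finsupp.single n a))
    refine ⟨g, fun k hk => ?_, fun h => ha ?_⟩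
    · rw [hg, toAdd_ofAdd, Finsupp.single_eq_of_ne (by omega)]
    · simpa [hg] using h n le_rfl
  refine ⟨S, strictMono_nat_of_lt_succ fun n => ?_, fun n h => ?_, ?_⟩
  · obtain ⟨g, hg, hg'⟩ := hsep n
    exact SetLike.lt_iff_le_and_exists.mpr
      ⟨fun x hx k hk => hx k (by omega), g, hg, hg'⟩
  · obtain ⟨g, -, hg⟩ := hsep n
    exact hg (h ▸ Subgroup.mem_top g)
  · refine Set.eq_univ_of_forall fun g => Set.mem_iUnion.mpr ?_
    obtain ⟨n, hn⟩ := (f g).toAdd.support.exists_nat_subset_range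
    refine ⟨n, fun k hk => Finsupp.notMem_support_iff.mp fun h => ?_⟩
    have := Finset.mem_range.mp (hn h)
    omega

theorem exists_lt_card_support (hf : Function.Surjective f) (n : ℕ) :
    ∃ g, n < (f g).toAdd.support.card := by
  classical
  obtain ⟨a, ha⟩ := exists_ne (0 : A)
  obtain ⟨g, hg⟩ := hf (Multiplicative.ofAdd
    (Finsupp.onFinset (Finset.range (n + 1)) (fun k => if k < n + 1 then a else 0) (by simp +contextual)))
  refine ⟨g, ?_⟩
  have : (f g).toAdd.support = Finset.range (n + 1) := by
    ext k
    simp [hg, ha]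
  simp [this]

theorem not_cayleyBounded_of_surjective_finsupp (hf : Function.Surjective f) :
    ¬ CayleyBounded Γ := by
  intro h
  let U : Set Γ := {g | (f g).toAdd.support.card ≤ 1}
  have hgen (d : ℕ →₀ A) : ∀ g, (f g).toAdd = d → g ∈ Subgroup.closure U := by
    induction d using Finsupp.induction with
    | zero => exact fun g hg => Subgroup.subset_closure (by simp [U, hg])
    | single_add k b d _ _ ih =>
      intro g hg
      obtain ⟨s, hs⟩ := hf (Multiplicative.ofAdd (Finsupp.single k b))
      have hsU : s ∈ U := by
        simpa [U, hs] using Finset.card_le_card (Finsupp.support_single_subset (a := k) (b := b))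
      have := ih (s⁻¹ * g) (by simp [hs, hg])
      simpa using mul_mem (Subgroup.subset_closure hsU) this
  obtain ⟨n, hn⟩ := h U ((Subgroup.eq_top_iff' _).mpr fun g => hgen _ g rfl)
  have hlist (l : List Γ) (hl : ∀ x ∈ l, x ∈ U ∪ U⁻¹ ∪ {1}) :
      (f l.prod).toAdd.support.card ≤ l.length := by
    induction l with
    | nil => simp
    | cons x l ih =>
      have hx : (f x).toAdd.support.card ≤ 1 := by
        rcases hl x (by simp) with (hx | hx) | hx
        · exact hx
        · simpa [U, Finsupp.support_neg] using hx
        · simp [Set.mem_singleton_iff.mp hx]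
      have := ih fun y hy => hl y (by simp [hy])
      have := Finsupp.card_support_add_le (f x).toAdd (f l.prod).toAdd
      rw [List.prod_cons, map_mul, toAdd_mul, List.length_cons]
      omega
  obtain ⟨g, hg⟩ := exists_lt_card_support f hf n
  obtain ⟨w, hw, rfl⟩ := hn g
  have := hlist (List.ofFn w) (by simpa [List.forall_mem_ofFn_iff] using hw)
  rw [List.length_ofFn] at this
  omega

theorem not_stronglyBounded_of_surjective_finsupp (hf : Function.Surjective f) :
    ¬ StronglyBounded Γ := by
  intro h
  let _ := finsuppHammingMetric A
  have hdist (u v : ℕ →₀ A) : dist u v = ((u - v).support.card : ℝ) := rfl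
  let φ : Γ →* ((ℕ →₀ A) ≃ᵢ (ℕ →₀ A)) :=
    { toFun := fun g =>
        { toEquiv := Equiv.addLeft (f g).toAdd
          isometry_toFun := Isometry.of_dist_eq fun u v => by simp [hdist] }
      map_one' := by ext; simp
      map_mul' := fun g g' => by
        ext
        simp }
  have hφ (g : Γ) : φ g 0 = (f g).toAdd := add_zero _
  obtain ⟨r, hr⟩ := (Metric.isBounded_iff_subset_closedBall (0 : ℕ →₀ A)).mp (h _ φ 0)
  obtain ⟨n, hn⟩ := exists_nat_ge r
  obtain ⟨g, hg⟩ := exists_lt_card_support f hf n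
  have hle : dist (φ g 0) 0 ≤ r := hr ⟨g, rfl⟩
  rw [hφ, hdist, sub_zero] at hle
  have : ((f g).toAdd.support.card : ℝ) ≤ n := hle.trans hn
  exact absurd (by exact_mod_cast this) hg.not_ge

end Quotient

/-- If `G` is a finite group which is not perfect and `I` is an infinite set, then `G^I`
has cofinality `ω`, is not Cayley bounded, and in particular is not strongly bounded. -/
theorem pi_not_stronglyBounded_of_not_perfect (G : Type) [Group G] [Finite G]
    (hnp : commutator G ≠ ⊤) (I : Type) [Infinite I] :
    CofinalityOmega (I → G) ∧ ¬ CayleyBounded (I → G) ∧ ¬ StronglyBounded (I → G) := by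
  obtain ⟨p, hp, f, hf⟩ := exists_surjective_pi_multiplicative_finsupp G hnp I
  have : Fact p.Prime := ⟨hp⟩
  exact ⟨cofinalityOmega_of_surjective_finsupp f hf,
    not_cayleyBounded_of_surjective_finsupp f hf,
    not_stronglyBounded_of_surjective_finsupp f hf⟩
end

section
/- Let E be a set and (𝒳ᵢ)ᵢ∈ℕ an increasing sequence of collections of subsets of E such that for every i: ∅ ∈ 𝒳ᵢ₊₁, E ∈ 𝒳ᵢ₊₁, and for all A, B ∈ 𝒳ᵢ, both the symmetric difference A ∆ B and the intersection A ∩ B belong to 𝒳ᵢ₊₁. If ⋃ᵢ 𝒳ᵢ is the full power set 𝒫(E), then 𝒳ᵢ = 𝒫(E) for some i. -/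
/-- `A` has subsets outside every member of the sequence `𝒳`. -/
def Unabsorbed {E : Type*} (𝒳 : ℕ → Set (Set E)) (A : Set E) : Prop :=
  ∀ i, ∃ B ⊆ A, B ∉ 𝒳 i

section Unabsorbed

variable {E : Type*} {𝒳 : ℕ → Set (Set E)}

/-- An unabsorbed set splits as the union of two disjoint sets, one of them unabsorbed and
the other outside a prescribed member of the sequence. -/
theorem Unabsorbed.exists_subset_sdiff_notMem {A : Set E} (hA : Unabsorbed 𝒳 A)
    (hmono : Monotone 𝒳)
    (hsymm : ∀ i, ∀ A ∈ 𝒳 i, ∀ B ∈ 𝒳 i, symmDiff A B ∈ 𝒳 (i + 1))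
    (hexh : ∀ A, ∃ i, A ∈ 𝒳 i) (n : ℕ) :
    ∃ A' ⊆ A, Unabsorbed 𝒳 A' ∧ A \ A' ∉ 𝒳 n := by
  obtain ⟨a, ha⟩ := hexh A
  obtain ⟨C, hCA, hC⟩ := hA (max a n + 1)
  have hCn : C ∉ 𝒳 n := fun h ↦ hC (hmono (by omega) h)
  have hdiff : A \ C ∉ 𝒳 n := fun h ↦ hC <| by
    have := hsymm _ A (hmono (le_max_left a n) ha) _ (hmono (le_max_right a n) h)
    convert this using 1
    ext x
    have := @hCA x
    simp only [Set.mem_symmDiff, Set.mem_sdiff]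
    tauto
  by_cases hbad : Unabsorbed 𝒳 C
  · exact ⟨C, hCA, hbad, hdiff⟩
  refine ⟨A \ C, Set.sdiff_subset, fun i ↦ ?_, by rwa [Set.sdiff_sdiff_cancel_left hCA]⟩
  simp only [Unabsorbed, not_forall, not_exists, not_and, not_not] at hbad
  obtain ⟨j, hj⟩ := hbad
  obtain ⟨B, hBA, hB⟩ := hA (max i j + 1)
  refine ⟨B \ C, Set.sdiff_subset_sdiff_left hBA, fun h ↦ hB ?_⟩
  have := hsymm _ _ (hmono (le_max_left i j) h) _
    (hmono (le_max_right i j) (hj (B ∩ C) Set.inter_subset_right))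
  convert this using 1
  ext x
  simp only [Set.mem_symmDiff, Set.mem_sdiff, Set.mem_inter_iff]
  tauto

/-- If some set is unabsorbed, there are pairwise disjoint sets `C n ∉ 𝒳 n`. -/
theorem Unabsorbed.exists_pairwise_disjoint_notMem {A : Set E} (hA : Unabsorbed 𝒳 A)
    (hmono : Monotone 𝒳)
    (hsymm : ∀ i, ∀ A ∈ 𝒳 i, ∀ B ∈ 𝒳 i, symmDiff A B ∈ 𝒳 (i + 1))
    (hexh : ∀ A, ∃ i, A ∈ 𝒳 i) :
    ∃ C : ℕ → Set E, Pairwise (Function.onFun Disjoint C) ∧ ∀ n, C n ∉ 𝒳 n := by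
  choose f hfsub hfbad hf using fun (n : ℕ) (A : {A // Unabsorbed 𝒳 A}) ↦
    A.2.exists_subset_sdiff_notMem hmono hsymm hexh n
  let s : ℕ → {A // Unabsorbed 𝒳 A} :=
    Nat.rec ⟨A, hA⟩ fun n A ↦ ⟨f n A, hfbad n A⟩
  have hs : Antitone fun n : ℕ ↦ (s n).1 :=
    antitone_nat_of_succ_le fun n ↦ hfsub n (s n)
  refine ⟨fun n ↦ (s n).1 \ (s (n + 1)).1, ?_, fun n ↦ hf n (s n)⟩
  refine (pairwise_disjoint_on _).2 fun m n hmn ↦ Set.disjoint_left.2 fun x hm hn ↦ ?_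
  exact hm.2 (hs (Nat.succ_le_of_lt hmn) hn.1)

/-- Pairwise disjoint sets of an exhausted power set cannot all be unabsorbed. -/
theorem not_forall_unabsorbed_of_pairwise_disjoint (hmono : Monotone 𝒳)
    (hinter : ∀ i, ∀ A ∈ 𝒳 i, ∀ B ∈ 𝒳 i, A ∩ B ∈ 𝒳 (i + 1))
    (hexh : ∀ A, ∃ i, A ∈ 𝒳 i) {D : ℕ → Set E}
    (hdisj : Pairwise (Function.onFun Disjoint D)) : ¬ ∀ n, Unabsorbed 𝒳 (D n) := by
  intro hD
  choose m hm using fun n ↦ hexh (D n)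
  choose B hBD hB using fun n ↦ hD n (max n (m n) + 1)
  obtain ⟨i, hi⟩ := hexh (⋃ n, B n)
  have hBi : (⋃ n, B n) ∩ D i = B i := by
    ext x
    simp only [Set.mem_inter_iff, Set.mem_iUnion]
    refine ⟨fun ⟨⟨n, hn⟩, hx⟩ ↦ ?_, fun hx ↦ ⟨⟨i, hx⟩, hBD i hx⟩⟩
    obtain rfl : n = i := by
      by_contra hne
      exact Set.disjoint_left.1 (hdisj hne) (hBD n hn) hx
    exact hn
  exact hB i (hBi ▸ hinter _ _ (hmono (le_max_left i (m i)) hi) _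
    (hmono (le_max_right i (m i)) (hm i)))

end Unabsorbed


/-- Let `E` be a set and `(𝒳 i)` an increasing sequence of collections of subsets of `E`
such that each `𝒳 (i+1)` contains `∅`, `E`, and the symmetric differences and
intersections of members of `𝒳 i`. If `⋃ i, 𝒳 i` is the full power set of `E`, then
`𝒳 i` is the full power set for some `i`. -/
theorem powerSet_exhaustion (E : Type) (𝒳 : ℕ → Set (Set E)) (hmono : Monotone 𝒳)
    (hempty : ∀ i, (∅ : Set E) ∈ 𝒳 (i + 1))
    (huniv : ∀ i, (Set.univ : Set E) ∈ 𝒳 (i + 1))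
    (hsymm : ∀ i, ∀ A ∈ 𝒳 i, ∀ B ∈ 𝒳 i, symmDiff A B ∈ 𝒳 (i + 1))
    (hinter : ∀ i, ∀ A ∈ 𝒳 i, ∀ B ∈ 𝒳 i, A ∩ B ∈ 𝒳 (i + 1))
    (hexh : (⋃ i, 𝒳 i) = Set.univ) :
    ∃ i, 𝒳 i = Set.univ := by
  have hexh' : ∀ A, ∃ i, A ∈ 𝒳 i := fun A ↦ Set.mem_iUnion.1 (hexh ▸ Set.mem_univ A)
  by_contra! hne
  have huniv_unabsorbed : Unabsorbed 𝒳 Set.univ := fun i ↦ by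
    obtain ⟨B, hB⟩ := (Set.ne_univ_iff_exists_notMem _).1 (hne i)
    exact ⟨B, Set.subset_univ B, hB⟩
  obtain ⟨C, hdisj, hC⟩ :=
    huniv_unabsorbed.exists_pairwise_disjoint_notMem hmono hsymm hexh'
  refine not_forall_unabsorbed_of_pairwise_disjoint hmono hinter hexh'
    (D := fun m ↦ ⋃ k, C (Nat.pair m k)) (fun m n hmn ↦ ?_) fun m i ↦ ?_
  · simp only [Function.onFun, Set.disjoint_iUnion_left, Set.disjoint_iUnion_right]
    exact fun k l ↦ hdisj fun h ↦ hmn (Nat.pair_eq_pair.1 h).1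
  · exact ⟨C (Nat.pair m i), Set.subset_iUnion (fun k ↦ C (Nat.pair m k)) i,
      fun h ↦ hC _ (hmono (Nat.right_le_pair m i) h)⟩
end

section
/- Let A be a finite (not necessarily associative or commutative) ring with unity, E a set, and (𝒳ᵢ)ᵢ∈ℕ an increasing sequence of subsets of the product ring A^E (all functions E → A with pointwise operations) such that ℛ(𝒳ᵢ) ⊆ 𝒳ᵢ₊₁ for all i. If ⋃ᵢ 𝒳ᵢ = A^E, then 𝒳ᵢ = A^E for some i. -/
open scoped Pointwise

/-- For a subset `X` of a (possibly non-associative, non-commutative) ring with unity,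
`RSet X = X ∪ {-1, 0, 1} ∪ {x + y : x, y ∈ X} ∪ {xy : x, y ∈ X}`. -/
def RSet {A : Type} [NonAssocRing A] : Set A → Set A := fun X =>
  X ∪ {-1, 0, 1} ∪ (X + X) ∪ (X * X)

/-- An exhaustion of the power set of `E` by an increasing sequence of families, in which binary
unions, intersections and differences cost a bounded number of steps, stabilises. -/
theorem Set.exists_forall_mem_of_exhaustion {E : Type*} (𝒴 : ℕ → Set (Set E)) (c : ℕ)
    (hmono : Monotone 𝒴)
    (hunion : ∀ i S T, S ∈ 𝒴 i → T ∈ 𝒴 i → S ∪ T ∈ 𝒴 (i + c))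
    (hinter : ∀ i S T, S ∈ 𝒴 i → T ∈ 𝒴 i → S ∩ T ∈ 𝒴 (i + c))
    (hdiff : ∀ i S T, S ∈ 𝒴 i → T ∈ 𝒴 i → S \ T ∈ 𝒴 (i + c))
    (hexh : ∀ S, ∃ i, S ∈ 𝒴 i) : ∃ i, ∀ S, S ∈ 𝒴 i := by
  let Good : Set E → Prop := fun F => ∃ i, ∀ S ⊆ F, S ∈ 𝒴 i
  have good_of_diff : ∀ F S, S ⊆ F → Good S → Good (F \ S) → Good F := by
    rintro F S - ⟨i, hi⟩ ⟨j, hj⟩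
    refine ⟨i + j + c, fun T hT => ?_⟩
    have h := hunion (i + j) (T ∩ S) (T \ S)
      (hmono (Nat.le_add_right i j) (hi _ Set.inter_subset_right))
      (hmono (Nat.le_add_left j i) (hj _ (Set.sdiff_subset_sdiff_left hT)))
    rwa [Set.inter_union_sdiff] at h
  by_contra hbad
  have huniv : ¬ Good Set.univ := fun ⟨i, hi⟩ => hbad ⟨i, fun S => hi S (Set.subset_univ S)⟩
  have step : ∀ (n : ℕ) (F : {F : Set E // ¬ Good F}),
      ∃ G : {F : Set E // ¬ Good F}, G.1 ⊆ F.1 ∧ F.1 \ G.1 ∉ 𝒴 n := by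
    rintro n ⟨F, hF⟩
    obtain ⟨m, hm⟩ := hexh F
    obtain ⟨S, hSF, hS⟩ : ∃ S ⊆ F, S ∉ 𝒴 (m + n + c) := by
      by_contra! h
      exact hF ⟨_, h⟩
    by_cases hgood : Good S
    · refine ⟨⟨F \ S, fun h => hF (good_of_diff F S hSF hgood h)⟩, Set.sdiff_subset, ?_⟩
      intro h
      simp only [Set.sdiff_sdiff_cancel_left hSF] at h
      exact hS (hmono (by lia) h)
    · refine ⟨⟨S, hgood⟩, hSF, fun h => hS ?_⟩
      have h' := hdiff (m + n) F (F \ S) (hmono (by lia) hm) (hmono (by lia) h)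
      rwa [Set.sdiff_sdiff_cancel_left hSF] at h'
  choose next hnext_sub hnext using step
  let B : ℕ → {F : Set E // ¬ Good F} := fun n => Nat.rec ⟨Set.univ, huniv⟩ next n
  have hB : Antitone fun n => (B n).1 := antitone_nat_of_succ_le fun n => hnext_sub n (B n)
  let D : ℕ → Set E := fun n => (B n).1 \ (B (n + 1)).1
  have hD : ∀ n, D n ∉ 𝒴 n := fun n => hnext n (B n)
  have hdisj : ∀ m n x, x ∈ D m → x ∈ D n → m = n := by
    intro m n x hm hn
    rcases lt_trichotomy m n with h | h | h
    · exact absurd (hB (Nat.succ_le_of_lt h) hn.1) hm.2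
    · exact h
    · exact absurd (hB (Nat.succ_le_of_lt h) hm.1) hn.2
  choose m hm using fun k => hexh (⋃ j, D (Nat.pair k j))
  obtain ⟨p, hp⟩ := hexh (⋃ k, D (Nat.pair k (m k + k + c)))
  have hEq : (⋃ k, D (Nat.pair k (m k + k + c))) ∩ (⋃ j, D (Nat.pair p j)) =
      D (Nat.pair p (m p + p + c)) := by
    ext x
    simp only [Set.mem_inter_iff, Set.mem_iUnion]
    constructor
    · rintro ⟨⟨k, hk⟩, j, hj⟩
      obtain ⟨rfl, -⟩ := Nat.pair_eq_pair.1 (hdisj _ _ x hk hj)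
      exact hk
    · exact fun h => ⟨⟨p, h⟩, _, h⟩
  have h := hinter (m p + p) _ _ (hmono (Nat.le_add_left p (m p)) hp)
    (hmono (Nat.le_add_right (m p) p) (hm p))
  rw [hEq] at h
  exact hD _ (hmono (Nat.right_le_pair p _) h)

/-- Let `A` be a finite (not necessarily associative or commutative) ring with unity,
`E` a set, and `(𝒳 i)` an increasing sequence of subsets of the product ring `A^E` with
`RSet (𝒳 i) ⊆ 𝒳 (i+1)` for all `i`. If `⋃ i, 𝒳 i = A^E`, then `𝒳 i = A^E` for some `i`. -/
theorem pi_ring_exhaustion (A : Type) [NonAssocRing A] [Finite A] (E : Type)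
    (𝒳 : ℕ → Set (E → A)) (hmono : Monotone 𝒳)
    (hR : ∀ i, RSet (𝒳 i) ⊆ 𝒳 (i + 1))
    (hexh : (⋃ i, 𝒳 i) = Set.univ) :
    ∃ i, 𝒳 i = Set.univ := by
  classical
  have hadd : ∀ i x y, x ∈ 𝒳 i → y ∈ 𝒳 i → x + y ∈ 𝒳 (i + 1) := fun i x y hx hy =>
    hR i (Or.inl (Or.inr (Set.add_mem_add hx hy)))
  have hmul : ∀ i x y, x ∈ 𝒳 i → y ∈ 𝒳 i → x * y ∈ 𝒳 (i + 1) := fun i x y hx hy =>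
    hR i (Or.inr (Set.mul_mem_mul hx hy))
  have hneg_one : ∀ i, -1 ∈ 𝒳 (i + 1) := fun i => hR i (by simp [RSet])
  have hzero : 0 ∈ 𝒳 1 := hR 0 (by simp [RSet])
  have hmem : ∀ x, ∃ i, x ∈ 𝒳 i := fun x => Set.mem_iUnion.1 (hexh ▸ Set.mem_univ x)
  let χ : Set E → E → A := fun S => S.indicator 1
  have hχ_inter : ∀ S T, χ (S ∩ T) = χ S * χ T := fun S T => by
    ext e
    by_cases hS : e ∈ S <;> by_cases hT : e ∈ T <;> simp [χ, hS, hT]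
  have hχ_diff : ∀ S T, χ (S \ T) = χ S + -1 * (χ S * χ T) := fun S T => by
    ext e
    by_cases hS : e ∈ S <;> by_cases hT : e ∈ T <;> simp [χ, hS, hT]
  have hχ_union : ∀ S T, χ (S ∪ T) = χ T + χ (S \ T) := fun S T => by
    ext e
    by_cases hS : e ∈ S <;> by_cases hT : e ∈ T <;> simp [χ, hS, hT]
  have hdiff : ∀ i S T, χ S ∈ 𝒳 i → χ T ∈ 𝒳 i → χ (S \ T) ∈ 𝒳 (i + 3) := by
    intro i S T hS hT
    rw [hχ_diff]
    exact hadd _ _ _ (hmono (by lia) hS) (hmul _ _ _ (hneg_one _) (hmul _ _ _ hS hT))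
  obtain ⟨n, hn⟩ : ∃ n, ∀ S, χ S ∈ 𝒳 n := by
    refine Set.exists_forall_mem_of_exhaustion (fun i => {S | χ S ∈ 𝒳 i}) 4
      (fun i j hij S hS => hmono hij hS) ?_ ?_ ?_ fun S => hmem (χ S)
    · intro i S T hS hT
      change χ (S ∪ T) ∈ 𝒳 (i + 4)
      rw [hχ_union]
      exact hadd _ _ _ (hmono (by lia) hT) (hdiff i S T hS hT)
    · intro i S T hS hT
      change χ (S ∩ T) ∈ 𝒳 (i + 4)
      rw [hχ_inter]
      exact hmono (by lia) (hmul i _ _ hS hT)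
    · exact fun i S T hS hT => hmono (by lia) (hdiff i S T hS hT)
  have hsum : ∀ s : Finset A, ∃ i, ∀ f : E → A,
      ∑ a ∈ s, Function.const E a * χ (f ⁻¹' {a}) ∈ 𝒳 i := by
    intro s
    induction s using Finset.induction_on with
    | empty => exact ⟨1, fun f => by simpa using hzero⟩
    | insert a s ha ih =>
      obtain ⟨i, hi⟩ := ih
      obtain ⟨j, hj⟩ := hmem (Function.const E a)
      refine ⟨n + j + 1 + i + 1, fun f => ?_⟩
      rw [Finset.sum_insert ha]
      exact hadd _ _ _
        (hmono (by lia) (hmul (n + j) _ _ (hmono (by lia) hj) (hmono (by lia) (hn _))))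
        (hmono (by lia) (hi f))
  have := Fintype.ofFinite A
  obtain ⟨i, hi⟩ := hsum Finset.univ
  refine ⟨i, Set.eq_univ_of_forall fun f => ?_⟩
  convert hi f
  ext e
  simp [χ, Set.indicator_apply]
end

section
/- Let A be a Boolean ring and X ⊆ A a subset with 0 ∈ X which is symmetric, i.e. closed under x ↦ 1 − x. Then for all n ≥ 0, ℛⁿ(X) ⊆ 𝒟^{2n}(X), where ℛⁿ and 𝒟^{2n} denote the n-fold and 2n-fold iterates of ℛ and 𝒟. -/
open scoped Pointwise

/-- For a subset `X` of a Boolean ring,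
`DSet X = X ∪ {0, 1} ∪ {x + y : x, y ∈ X, xy = 0} ∪ {xy : x, y ∈ X}`. -/
def DSet {A : Type} [BooleanRing A] : Set A → Set A := fun X =>
  X ∪ {0, 1} ∪ {z | ∃ x ∈ X, ∃ y ∈ X, x * y = 0 ∧ z = x + y} ∪ (X * X)

section DSet

variable {A : Type} [BooleanRing A] {S T : Set A} {x y z : A}

theorem subset_DSet : T ⊆ DSet T := fun _ hx => Or.inl (Or.inl (Or.inl hx))

theorem zero_mem_DSet : (0 : A) ∈ DSet T := Or.inl (Or.inl (Or.inr (Or.inl rfl)))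

theorem one_mem_DSet : (1 : A) ∈ DSet T := Or.inl (Or.inl (Or.inr (Or.inr rfl)))

theorem add_mem_DSet (hx : x ∈ T) (hy : y ∈ T) (hxy : x * y = 0) : x + y ∈ DSet T :=
  Or.inl (Or.inr ⟨x, hx, y, hy, hxy, rfl⟩)

theorem mul_mem_DSet (hx : x ∈ T) (hy : y ∈ T) : x * y ∈ DSet T :=
  Or.inr (Set.mul_mem_mul hx hy)

theorem BooleanRing.mul_one_sub_self (x : A) : x * (1 - x) = 0 := by
  rw [mul_sub, mul_one, BooleanRing.mul_self, sub_self]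

/-- The sum of two elements is an orthogonal sum of two products of the elements and their
complements. -/
theorem add_mem_DSet_DSet (hx : x ∈ T) (hx' : 1 - x ∈ T) (hy : y ∈ T) (hy' : 1 - y ∈ T) :
    x + y ∈ DSet (DSet T) := by
  have key : x + y = x * (1 - y) + (1 - x) * y := by
    linear_combination BooleanRing.add_self (x * y)
  rw [key]
  refine add_mem_DSet (mul_mem_DSet hx hy') (mul_mem_DSet hx' hy) ?_
  linear_combination (1 - y) * y * BooleanRing.mul_one_sub_self x

theorem one_sub_mul_mem_DSet_DSet (hx : x ∈ T) (hx' : 1 - x ∈ T) (hy' : 1 - y ∈ T) :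
    1 - x * y ∈ DSet (DSet T) := by
  have key : 1 - x * y = (1 - x) + x * (1 - y) := by ring
  rw [key]
  refine add_mem_DSet (subset_DSet hx') (mul_mem_DSet hx hy') ?_
  linear_combination (1 - y) * BooleanRing.mul_one_sub_self x

/-- If `T` contains every element of `S` together with its complement, then `DSet (DSet T)`
contains every element of `RSet S` together with its complement. -/
theorem mem_DSet_DSet_of_mem_RSet (h : ∀ x ∈ S, x ∈ T ∧ 1 - x ∈ T) (hz : z ∈ RSet S) :
    z ∈ DSet (DSet T) ∧ 1 - z ∈ DSet (DSet T) := by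
  rcases hz with ((hz | hz) | ⟨x, hx, y, hy, rfl⟩) | ⟨x, hx, y, hy, rfl⟩
  · exact (h z hz).imp (fun h => subset_DSet (subset_DSet h))
      (fun h => subset_DSet (subset_DSet h))
  · rcases hz with rfl | rfl | rfl
    · rw [BooleanRing.neg_eq, sub_self]
      exact ⟨one_mem_DSet, zero_mem_DSet⟩
    · rw [sub_zero]
      exact ⟨zero_mem_DSet, one_mem_DSet⟩
    · rw [sub_self]
      exact ⟨one_mem_DSet, zero_mem_DSet⟩
  · obtain ⟨hx, hx'⟩ := h x hx
    obtain ⟨hy, hy'⟩ := h y hy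
    refine ⟨add_mem_DSet_DSet hx hx' hy hy', ?_⟩
    have key : 1 - (x + y) = (1 - x) + y := by
      linear_combination -BooleanRing.add_self y
    change 1 - (x + y) ∈ _
    rw [key]
    exact add_mem_DSet_DSet hx' (by rwa [sub_sub_cancel]) hy hy'
  · obtain ⟨hx, hx'⟩ := h x hx
    obtain ⟨hy, hy'⟩ := h y hy
    exact ⟨subset_DSet (mul_mem_DSet hx hy), one_sub_mul_mem_DSet_DSet hx hx' hy'⟩

theorem mem_DSet_iterate_of_mem_RSet_iterate (h : ∀ x ∈ T, 1 - x ∈ T) (n : ℕ) :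
    ∀ z ∈ RSet^[n] T, z ∈ DSet^[2 * n] T ∧ 1 - z ∈ DSet^[2 * n] T := by
  induction n with
  | zero => exact fun z hz => ⟨hz, h z hz⟩
  | succ n ih =>
    intro z hz
    rw [Function.iterate_succ_apply'] at hz
    rw [Nat.mul_succ, Function.iterate_succ_apply', Function.iterate_succ_apply']
    exact mem_DSet_DSet_of_mem_RSet ih hz

end DSet

/-- If `X` is a subset of a Boolean ring containing `0` and closed under `x ↦ 1 - x`,
then `RSet^[n] X ⊆ DSet^[2n] X` for all `n`. -/
theorem RSet_iterate_subset_DSet_iterate (A : Type) [BooleanRing A] (X : Set A)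
    (h0 : (0 : A) ∈ X) (hsymm : ∀ x ∈ X, (1 : A) - x ∈ X) (n : ℕ) :
    RSet^[n] X ⊆ DSet^[2 * n] X := by
  exact fun z hz => (mem_DSet_iterate_of_mem_RSet_iterate hsymm n z hz).1
end

section
/- Let A be a Boolean ring and X ⊆ A a subset with 0 ∈ X which is symmetric, i.e. closed under x ↦ 1 − x. Then for all n ≥ 0, 𝒟ⁿ(X) ⊆ 𝒱_{2^{2ⁿ}}(ℐ_{2ⁿ}(X)), where 𝒟ⁿ denotes the n-fold iterate of 𝒟. -/
open scoped Pointwise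

/-- `ISet k X = {x₁x₂⋯x_k : x₁, …, x_k ∈ X}`. -/
def ISet {A : Type} [BooleanRing A] (k : ℕ) (X : Set A) : Set A :=
  {z | ∃ x : Fin k → A, (∀ i, x i ∈ X) ∧ z = ∏ i, x i}

/-- `VSet k X = {x₁ + ⋯ + x_k : x₁, …, x_k ∈ X, xᵢxⱼ = 0 for i ≠ j}`. -/
def VSet {A : Type} [BooleanRing A] (k : ℕ) (X : Set A) : Set A :=
  {z | ∃ x : Fin k → A, (∀ i, x i ∈ X) ∧ (∀ i j, i ≠ j → x i * x j = 0) ∧ z = ∑ i, x i}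

/-- The atom indexed by `f` of the Boolean subring generated by the family `x`. -/
def boolAtom {A ι : Type} [BooleanRing A] [Fintype ι] (x : ι → A) (f : ι → Bool) : A :=
  ∏ i, if f i then x i else 1 - x i

section boolAtom

variable {A ι : Type} [BooleanRing A] [Fintype ι] (x : ι → A)

lemma sum_boolAtom [DecidableEq ι] : ∑ f, boolAtom x f = 1 := by
  have h := Fintype.prod_sum fun (i : ι) (b : Bool) => if b then x i else 1 - x i
  simpa [boolAtom] using h.symm

lemma boolAtom_mul_generator (f : ι → Bool) (i : ι) :
    boolAtom x f * x i = 0 ∨ boolAtom x f * x i = boolAtom x f := by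
  classical
  unfold boolAtom
  rw [← Finset.prod_erase_mul _ _ (Finset.mem_univ i), mul_assoc]
  cases f i
  · left
    simp [sub_mul, BooleanRing.mul_self]
  · right
    simp [BooleanRing.mul_self]

lemma boolAtom_mul_boolAtom_of_ne {f g : ι → Bool} (h : f ≠ g) :
    boolAtom x f * boolAtom x g = 0 := by
  obtain ⟨i, hi⟩ := Function.ne_iff.mp h
  unfold boolAtom
  rw [← Finset.prod_mul_distrib]
  refine Finset.prod_eq_zero (Finset.mem_univ i) ?_
  cases hf : f i <;> cases hg : g i <;>
    simp_all [mul_sub, sub_mul, BooleanRing.mul_self]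

lemma boolAtom_mul_of_mem_closure (f : ι → Bool) {z : A}
    (hz : z ∈ Subring.closure (Set.range x)) :
    boolAtom x f * z = 0 ∨ boolAtom x f * z = boolAtom x f := by
  induction hz using Subring.closure_induction with
  | mem z hz =>
    obtain ⟨i, rfl⟩ := hz
    exact boolAtom_mul_generator x f i
  | zero => simp
  | one => simp
  | add y z _ _ hy hz =>
    rcases hy with hy | hy <;> rcases hz with hz | hz <;> simp [mul_add, hy, hz, BooleanRing.add_self]
  | neg y _ hy => rwa [BooleanRing.neg_eq]
  | mul y z _ _ hy hz =>
    rcases hy with hy | hy <;> simp [← mul_assoc, hy, hz]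

end boolAtom

lemma closure_range_subset_VSet_ISet {A : Type} [BooleanRing A] {X : Set A}
    (h0 : (0 : A) ∈ X) (hsymm : ∀ x ∈ X, (1 : A) - x ∈ X) {k : ℕ} (hk : k ≠ 0)
    {x : Fin k → A} (hx : ∀ i, x i ∈ X) :
    (Subring.closure (Set.range x) : Set A) ⊆ VSet (2 ^ k) (ISet k X) := by
  intro z hz
  let e : Fin (2 ^ k) ≃ (Fin k → Bool) := Fintype.equivOfCardEq (by simp)
  refine ⟨fun j => boolAtom x (e j) * z, fun j => ?_, fun i j hij => ?_, ?_⟩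
  · rcases boolAtom_mul_of_mem_closure x (e j) hz with h | h
    · exact ⟨fun _ => 0, fun _ => h0, by simp [h, hk]⟩
    · refine ⟨fun i => if e j i then x i else 1 - x i, fun i => ?_, h⟩
      dsimp only
      split_ifs
      exacts [hx i, hsymm _ (hx i)]
  · rw [mul_mul_mul_comm, boolAtom_mul_boolAtom_of_ne x (e.injective.ne hij), zero_mul]
  · rw [← Finset.sum_mul, e.sum_comp (boolAtom x), sum_boolAtom, one_mul]

lemma exists_mem_closure_pair_of_mem_DSet {A : Type} [BooleanRing A] {Y : Set A} {z : A}
    (hz : z ∈ DSet Y) (h0 : (0 : A) ∈ Y) :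
    ∃ u ∈ Y, ∃ v ∈ Y, z ∈ Subring.closure {u, v} := by
  have key (u v : A) : u ∈ Subring.closure {u, v} ∧ v ∈ Subring.closure {u, v} :=
    ⟨Subring.subset_closure (by simp), Subring.subset_closure (by simp)⟩
  rcases hz with ((hz | rfl | rfl) | ⟨u, hu, v, hv, -, rfl⟩) | ⟨u, hu, v, hv, rfl⟩
  · exact ⟨z, hz, z, hz, (key z z).1⟩
  · exact ⟨0, h0, 0, h0, zero_mem _⟩
  · exact ⟨0, h0, 0, h0, one_mem _⟩
  · exact ⟨u, hu, v, hv, add_mem (key u v).1 (key u v).2⟩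
  · exact ⟨u, hu, v, hv, mul_mem (key u v).1 (key u v).2⟩

lemma zero_mem_DSet_iterate {A : Type} [BooleanRing A] {X : Set A}
    (h0 : (0 : A) ∈ X) (n : ℕ) : (0 : A) ∈ DSet^[n] X := by
  induction n with
  | zero => exact h0
  | succ n ih =>
    rw [Function.iterate_succ_apply']
    exact Or.inl (Or.inl (Or.inl ih))

lemma exists_mem_closure_range_of_mem_DSet_iterate {A : Type} [BooleanRing A] {X : Set A}
    (h0 : (0 : A) ∈ X) (n : ℕ) {z : A} (hz : z ∈ DSet^[n] X) :
    ∃ x : Fin (2 ^ n) → A, (∀ i, x i ∈ X) ∧ z ∈ Subring.closure (Set.range x) := by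
  induction n generalizing z with
  | zero => exact ⟨fun _ => z, fun _ => hz, Subring.subset_closure ⟨0, rfl⟩⟩
  | succ n ih =>
    rw [Function.iterate_succ_apply'] at hz
    obtain ⟨u, hu, v, hv, hz⟩ := exists_mem_closure_pair_of_mem_DSet hz (zero_mem_DSet_iterate h0 n)
    obtain ⟨x, hx, hux⟩ := ih hu
    obtain ⟨y, hy, hvy⟩ := ih hv
    rw [pow_succ, mul_two]
    refine ⟨Fin.append x y, fun i => ?_, ?_⟩
    · induction i using Fin.addCases with
      | left i => simpa only [Fin.append_left] using hx i
      | right i => simpa only [Fin.append_right] using hy i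
    · have hxy : Set.range x ∪ Set.range y ⊆ Set.range (Fin.append x y) := by
        rintro _ (⟨i, rfl⟩ | ⟨i, rfl⟩)
        exacts [⟨_, Fin.append_left x y i⟩, ⟨_, Fin.append_right x y i⟩]
      refine Subring.closure_le.mpr (Set.pair_subset ?_ ?_) hz
      · exact Subring.closure_mono (Set.subset_union_left.trans hxy) hux
      · exact Subring.closure_mono (Set.subset_union_right.trans hxy) hvy

/-- If `X` is a subset of a Boolean ring containing `0` and closed under `x ↦ 1 - x`,
then `DSet^[n] X ⊆ VSet_{2^(2^n)} (ISet_{2^n} X)` for all `n`. -/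
theorem DSet_iterate_subset_VSet_ISet (A : Type) [BooleanRing A] (X : Set A)
    (h0 : (0 : A) ∈ X) (hsymm : ∀ x ∈ X, (1 : A) - x ∈ X) (n : ℕ) :
    DSet^[n] X ⊆ VSet (2 ^ 2 ^ n) (ISet (2 ^ n) X) := by
  intro z hz
  obtain ⟨x, hx, hzx⟩ := exists_mem_closure_range_of_mem_DSet_iterate h0 n hz
  exact closure_range_subset_VSet_ISet h0 hsymm (pow_ne_zero n two_ne_zero) hx hzx
end

section
/- Let G be a finite group which is not nilpotent. Then there exist a ∈ G, b ∈ G with b ≠ 1, and a homogeneous monomial f : G² → G such that f(a, b) = b. -/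
/-- A function `f : Gⁿ → G` is a monomial if it belongs to the subgroup of the group of
functions `Gⁿ → G` (under pointwise multiplication) generated by the constant functions
and the coordinate projections. -/
def IsMonomial {G : Type} [Group G] {n : ℕ} (f : (Fin n → G) → G) : Prop :=
  f ∈ Subgroup.closure
    ((Set.range fun c : G => (fun _ => c : (Fin n → G) → G)) ∪
     (Set.range fun i : Fin n => (fun v => v i : (Fin n → G) → G)))

/-- A monomial is homogeneous if it takes the value `1` whenever one of its arguments
is `1`. -/
def IsHomogeneousMonomial {G : Type} [Group G] {n : ℕ} (f : (Fin n → G) → G) : Prop :=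
  IsMonomial f ∧ ∀ v : Fin n → G, (∃ i, v i = 1) → f v = 1

/-- In a finite non-nilpotent group the upper central series stabilizes at a proper subgroup. -/
theorem exists_upperCentralSeries_eq_succ_ne_top (G : Type*) [Group G] [Finite G]
    (hnn : ¬ Group.IsNilpotent G) :
    ∃ n, Subgroup.upperCentralSeries G n = Subgroup.upperCentralSeries G (n + 1) ∧
      Subgroup.upperCentralSeries G n ≠ ⊤ := by
  obtain ⟨n, hn⟩ := WellFoundedGT.monotone_chain_condition
    ⟨Subgroup.upperCentralSeries G, Subgroup.upperCentralSeries_mono G⟩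
  exact ⟨n, hn (n + 1) n.le_succ, fun h => hnn ((Group.isNilpotent_iff G).2 ⟨n, h⟩)⟩

open scoped commutatorElement

/-- In a finite non-nilpotent group, some nontrivial `b` lies in the normal closure of a
commutator `⁅b, a⁆`. -/
theorem exists_mem_normalClosure_commutatorElement (G : Type*) [Group G] [Finite G]
    (hnn : ¬ Group.IsNilpotent G) :
    ∃ a b : G, b ≠ 1 ∧ b ∈ Subgroup.normalClosure {⁅b, a⁆} := by
  obtain ⟨n, hZ, hne⟩ := exists_upperCentralSeries_eq_succ_ne_top G hnn
  set Z := Subgroup.upperCentralSeries G n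
  obtain ⟨N, ⟨hN, hNZ⟩, hmin⟩ := WellFounded.has_min (wellFounded_lt (α := Subgroup G))
    {N | N.Normal ∧ ¬ N ≤ Z} ⟨⊤, inferInstance, fun h => hne (top_le_iff.1 h)⟩
  obtain ⟨b, hbN, hbZ⟩ := SetLike.not_le_iff_exists.1 hNZ
  obtain ⟨a, ha⟩ : ∃ a, ⁅b, a⁆ ∉ Z := by
    by_contra! h
    rw [hZ] at hbZ
    exact hbZ (Subgroup.mem_upperCentralSeries_succ_iff.2 h)
  have hle : Subgroup.normalClosure {⁅b, a⁆} ≤ N := by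
    refine Subgroup.normalClosure_le_normal (Set.singleton_subset_iff.2 ?_)
    rw [commutatorElement_def, mul_assoc, mul_assoc, ← mul_assoc a]
    exact N.mul_mem hbN (hN.conj_mem _ (N.inv_mem hbN) a)
  have hnot : ¬ Subgroup.normalClosure {⁅b, a⁆} ≤ Z :=
    fun h => ha (h (Subgroup.subset_normalClosure rfl))
  have heq : Subgroup.normalClosure {⁅b, a⁆} = N :=
    eq_of_le_of_not_lt hle (hmin _ ⟨Subgroup.normalClosure_normal, hnot⟩)
  exact ⟨a, b, fun h => hbZ (h ▸ Z.one_mem), heq ▸ hbN⟩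

namespace IsHomogeneousMonomial

variable {G : Type} [Group G] {n : ℕ} {f g : (Fin n → G) → G}

theorem one : IsHomogeneousMonomial (1 : (Fin n → G) → G) :=
  ⟨Subgroup.one_mem _, fun _ _ => rfl⟩

theorem mul (hf : IsHomogeneousMonomial f) (hg : IsHomogeneousMonomial g) :
    IsHomogeneousMonomial (f * g) :=
  ⟨Subgroup.mul_mem _ hf.1 hg.1, fun v hv => by simp [hf.2 v hv, hg.2 v hv]⟩

theorem inv (hf : IsHomogeneousMonomial f) : IsHomogeneousMonomial f⁻¹ :=
  ⟨Subgroup.inv_mem _ hf.1, fun v hv => by simp [hf.2 v hv]⟩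

theorem conj (hf : IsHomogeneousMonomial f) (c : G) :
    IsHomogeneousMonomial ((fun _ => c) * f * (fun _ => c)⁻¹) := by
  have hc : (fun _ => c : (Fin n → G) → G) ∈ Subgroup.closure
      ((Set.range fun c : G => (fun _ => c : (Fin n → G) → G)) ∪
        (Set.range fun i : Fin n => (fun v => v i : (Fin n → G) → G))) :=
    Subgroup.subset_closure (Or.inl ⟨c, rfl⟩)
  exact ⟨Subgroup.mul_mem _ (Subgroup.mul_mem _ hc hf.1) (Subgroup.inv_mem _ hc),
    fun v hv => by simp [hf.2 v hv]⟩

theorem commutator :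
    IsHomogeneousMonomial (fun v : Fin 2 → G => ⁅v 1, v 0⁆) := by
  have hproj (i : Fin 2) : IsMonomial (fun v : Fin 2 → G => v i) :=
    Subgroup.subset_closure (Or.inr ⟨i, rfl⟩)
  refine ⟨Subgroup.mul_mem _ (Subgroup.mul_mem _ (Subgroup.mul_mem _ (hproj 1) (hproj 0))
    (Subgroup.inv_mem _ (hproj 1))) (Subgroup.inv_mem _ (hproj 0)), ?_⟩
  rintro v ⟨i, hi⟩
  fin_cases i <;> simp_all

/-- The subgroup of values taken at a point by homogeneous monomials. -/
def values (v : Fin n → G) : Subgroup G where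
  carrier := {x | ∃ f : (Fin n → G) → G, IsHomogeneousMonomial f ∧ f v = x}
  one_mem' := ⟨1, one, rfl⟩
  mul_mem' := by
    rintro _ _ ⟨f, hf, rfl⟩ ⟨g, hg, rfl⟩
    exact ⟨f * g, hf.mul hg, rfl⟩
  inv_mem' := by
    rintro _ ⟨f, hf, rfl⟩
    exact ⟨f⁻¹, hf.inv, rfl⟩

instance normal_values (v : Fin n → G) : (values v).Normal where
  conj_mem := by
    rintro _ ⟨f, hf, rfl⟩ c
    exact ⟨_, hf.conj c, rfl⟩

end IsHomogeneousMonomial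

/-- If `G` is a finite non-nilpotent group, then there exist `a ∈ G`, `b ∈ G - {1}` and a
homogeneous monomial `f : G² → G` such that `f(a, b) = b`. -/
theorem exists_homogeneous_monomial_fixed_point (G : Type) [Group G] [Finite G]
    (hnn : ¬ Group.IsNilpotent G) :
    ∃ (a b : G) (f : (Fin 2 → G) → G),
      b ≠ 1 ∧ IsHomogeneousMonomial f ∧ f ![a, b] = b := by
  obtain ⟨a, b, hb, hmem⟩ := exists_mem_normalClosure_commutatorElement G hnn
  have hle : Subgroup.normalClosure {⁅b, a⁆} ≤ IsHomogeneousMonomial.values ![a, b] :=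
    Subgroup.normalClosure_le_normal
      (Set.singleton_subset_iff.2 ⟨_, IsHomogeneousMonomial.commutator, rfl⟩)
  obtain ⟨f, hf, hfb⟩ := hle hmem
  exact ⟨a, b, f, hb, hf, hfb⟩
end

section
/- Let G be a finite group, I a set, and H = G^I the group of all functions I → G under pointwise multiplication. Suppose there exist a, b ∈ G and a homogeneous monomial f : G² → G with f(a, b) = b, and let N be the normal subgroup of G generated by b. Let (X_m)_{m∈ℕ} be an increasing sequence of subsets of H such that 𝒢(X_m) ⊆ X_{m+1} for all m and ⋃_m X_m = H. Then N^I = {h ∈ H : h(i) ∈ N for all i ∈ I} is contained in X_m for all sufficiently large m. -/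
open scoped Pointwise

/-- An increasing exhaustion of a group by subsets such that the elements obtained in one step
from a member belong to the next member. -/
structure IsGExhaustion {H : Type} [Group H] (X : ℕ → Set H) : Prop where
  mono : Monotone X
  step : ∀ m, GSet (X m) ⊆ X (m + 1)
  exists_mem : ∀ h, ∃ m, h ∈ X m

/-- A subset is bounded for `X` if it is contained in some member of `X`. -/
def BoundedFor {H : Type} (X : ℕ → Set H) (A : Set H) : Prop :=
  ∃ m, A ⊆ X m

namespace IsGExhaustion

section Group

variable {H : Type} [Group H] {X : ℕ → Set H}

lemma mul_mem (hX : IsGExhaustion X) {m : ℕ} {x y : H} (hx : x ∈ X m) (hy : y ∈ X m) :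
    x * y ∈ X (m + 1) :=
  hX.step m (Or.inr (Set.mul_mem_mul hx hy))

lemma inv_mem (hX : IsGExhaustion X) {m : ℕ} {x : H} (hx : x ∈ X m) : x⁻¹ ∈ X (m + 1) :=
  hX.step m (Or.inl (Or.inr (Set.inv_mem_inv.2 hx)))

lemma bounded_mul (hX : IsGExhaustion X) {A B : Set H} (hA : BoundedFor X A)
    (hB : BoundedFor X B) : BoundedFor X (A * B) := by
  obtain ⟨m, hm⟩ := hA
  obtain ⟨n, hn⟩ := hB
  refine ⟨max m n + 1, ?_⟩
  rintro _ ⟨x, hx, y, hy, rfl⟩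
  exact hX.mul_mem (hX.mono (le_max_left m n) (hm hx)) (hX.mono (le_max_right m n) (hn hy))

lemma bounded_inv (hX : IsGExhaustion X) {A : Set H} (hA : BoundedFor X A) :
    BoundedFor X A⁻¹ := by
  obtain ⟨m, hm⟩ := hA
  refine ⟨m + 1, fun x hx => ?_⟩
  simpa using hX.inv_mem (hm (Set.mem_inv.1 hx))

lemma bounded_singleton (hX : IsGExhaustion X) (x : H) : BoundedFor X {x} := by
  obtain ⟨m, hm⟩ := hX.exists_mem x
  exact ⟨m, Set.singleton_subset_iff.2 hm⟩

end Group

end IsGExhaustion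

lemma BoundedFor.subset {H : Type} {X : ℕ → Set H} {A B : Set H} (hB : BoundedFor X B)
    (h : A ⊆ B) : BoundedFor X A :=
  hB.imp fun _ hm => h.trans hm

/-- The functions which are constantly `x` on some subset of `J` and `1` elsewhere. -/
def indicatorsIn {G I : Type} [Group G] (x : G) (J : Set I) : Set (I → G) :=
  {h | ∃ K ⊆ J, h = K.mulIndicator fun _ => x}

lemma indicatorsIn_mono {G I : Type} [Group G] (x : G) {J K : Set I} (h : J ⊆ K) :
    indicatorsIn x J ⊆ indicatorsIn x K := by
  rintro _ ⟨L, hL, rfl⟩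
  exact ⟨L, hL.trans h, rfl⟩

namespace IsGExhaustion

variable {G I : Type} [Group G] {X : ℕ → Set (I → G)}

lemma bounded_indicatorsIn_union (hX : IsGExhaustion X) {x : G} {J K : Set I}
    (hJ : BoundedFor X (indicatorsIn x J)) (hK : BoundedFor X (indicatorsIn x K)) :
    BoundedFor X (indicatorsIn x (J ∪ K)) := by
  refine (hX.bounded_mul hJ hK).subset ?_
  rintro _ ⟨L, hL, rfl⟩
  refine ⟨_, ⟨L ∩ J, Set.inter_subset_right, rfl⟩, _, ⟨L \ J, ?_, rfl⟩, ?_⟩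
  · exact fun i hi => (hL hi.1).resolve_left hi.2
  · funext i
    by_cases hi : i ∈ L <;> by_cases hj : i ∈ J <;> simp [Set.mulIndicator, hi, hj]

/-- A monomial maps each member of an exhaustion to another one, with a uniform shift of index. -/
lemma exists_shift_of_isMonomial (hX : IsGExhaustion X) {n : ℕ} {f : (Fin n → G) → G}
    (hf : IsMonomial f) :
    ∃ c, ∀ m, ∀ u : Fin n → I → G, (∀ j, u j ∈ X m) →
      (fun i => f fun j => u j i) ∈ X (m + c) := by
  induction hf using Subgroup.closure_induction with
  | mem f hf =>
    rcases hf with ⟨g, rfl⟩ | ⟨j, rfl⟩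
    · obtain ⟨c, hc⟩ := hX.exists_mem fun _ => g
      exact ⟨c, fun m u _ => hX.mono (Nat.le_add_left c m) hc⟩
    · exact ⟨0, fun m u hu => hu j⟩
  | one =>
    obtain ⟨c, hc⟩ := hX.exists_mem 1
    exact ⟨c, fun m u _ => hX.mono (Nat.le_add_left c m) hc⟩
  | mul f g _ _ hf hg =>
    obtain ⟨c, hc⟩ := hf
    obtain ⟨d, hd⟩ := hg
    refine ⟨max c d + 1, fun m u hu => ?_⟩
    exact hX.mul_mem (m := m + max c d)
      (hX.mono (Nat.add_le_add_left (le_max_left c d) m) (hc m u hu))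
      (hX.mono (Nat.add_le_add_left (le_max_right c d) m) (hd m u hu))
  | inv f _ hf =>
    obtain ⟨c, hc⟩ := hf
    exact ⟨c + 1, fun m u hu => hX.inv_mem (hc m u hu)⟩

/-- A set of indices with unbounded indicators splits into two such sets. -/
lemma exists_split (hX : IsGExhaustion X) {x : G} {J : Set I}
    (hJ : ¬ BoundedFor X (indicatorsIn x J)) :
    ∃ K ⊆ J, ¬ BoundedFor X (indicatorsIn x K) ∧ ¬ BoundedFor X (indicatorsIn x (J \ K)) := by
  by_contra! hsplit
  have hprime : ∀ K ⊆ J, BoundedFor X (indicatorsIn x K) ∨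
      BoundedFor X (indicatorsIn x (J \ K)) := fun K hK => or_iff_not_imp_left.2 (hsplit K hK)
  have hstep : ∀ (n : ℕ) (L : Set I), ∃ D, BoundedFor X (indicatorsIn x L) →
      D ⊆ J ∧ Disjoint L D ∧ BoundedFor X (indicatorsIn x D) ∧
        D.mulIndicator (fun _ => x) ∉ X n := by
    intro n L
    by_contra! h
    have hL := (h ∅).1
    have hD : ∀ D ⊆ J, Disjoint L D → BoundedFor X (indicatorsIn x D) →
        D.mulIndicator (fun _ => x) ∈ X n := fun D => (h D).2
    let A : Set (I → G) := {h | ∃ K ⊆ J, BoundedFor X (indicatorsIn x K) ∧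
      h = K.mulIndicator fun _ => x}
    have hA : BoundedFor X A := by
      refine (hX.bounded_mul hL ⟨n, subset_rfl⟩).subset ?_
      rintro _ ⟨K, hKJ, hK, rfl⟩
      refine ⟨_, ⟨K ∩ L, Set.inter_subset_right, rfl⟩, _,
        hD (K \ L) (Set.sdiff_subset.trans hKJ) Set.disjoint_sdiff_right
          (hK.subset (indicatorsIn_mono x Set.sdiff_subset)), ?_⟩
      funext i
      by_cases hi : i ∈ K <;> by_cases hj : i ∈ L <;> simp [Set.mulIndicator, hi, hj]
    obtain ⟨p, hp⟩ := hA
    obtain ⟨q, hq⟩ := hX.bounded_mul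
      (hX.bounded_singleton (J.mulIndicator fun _ => x)) (hX.bounded_inv ⟨p, hp⟩)
    refine hJ ⟨max p q, ?_⟩
    rintro _ ⟨K, hKJ, rfl⟩
    rcases hprime K hKJ with hK | hK
    · exact hX.mono (le_max_left p q) (hp ⟨K, hKJ, hK, rfl⟩)
    · refine hX.mono (le_max_right p q) (hq ⟨_, rfl, _,
        Set.inv_mem_inv.2 ⟨J \ K, Set.sdiff_subset, hK, rfl⟩, ?_⟩)
      funext i
      by_cases hi : i ∈ K
      · simp [Set.mulIndicator, hi, hKJ hi]
      · by_cases hj : i ∈ J <;> simp [Set.mulIndicator, hi, hj]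
  choose D hD using hstep
  let L : ℕ → Set I := fun n => Nat.rec ∅ (fun k S => S ∪ D k S) n
  have hLsucc : ∀ n, L (n + 1) = L n ∪ D n (L n) := fun _ => rfl
  have hL : ∀ n, BoundedFor X (indicatorsIn x (L n)) := by
    intro n
    induction n with
    | zero =>
      refine (hX.bounded_singleton 1).subset ?_
      rintro _ ⟨K, hK, rfl⟩
      exact funext fun i => Set.mulIndicator_of_notMem (fun hi => hK hi) _
    | succ n ih =>
      rw [hLsucc]
      exact hX.bounded_indicatorsIn_union ih (hD n (L n) ih).2.2.1
  have hLmono : Monotone L := monotone_nat_of_le_succ fun n => by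
    rw [hLsucc]; exact Set.subset_union_left
  let E : ℕ → Set I := fun n => D n (L n)
  have hE : Pairwise (Function.onFun Disjoint E) := by
    refine (pairwise_disjoint_on E).2 fun m n hmn => ?_
    refine (hD n (L n) (hL n)).2.1.mono_left ?_
    exact Set.subset_union_right.trans (hLmono (Nat.succ_le_of_lt hmn))
  have hunb : ∀ (S : Set I) (e : ℕ → ℕ), (∀ n, n ≤ e n) → (∀ n, E (e n) ⊆ S) →
      ¬ BoundedFor X (indicatorsIn x S) := by
    rintro S e he hS ⟨m, hm⟩
    exact (hD (e m) (L (e m)) (hL _)).2.2.2 (hX.mono (he m) (hm ⟨_, hS m, rfl⟩))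
  rcases hprime (⋃ n, E (2 * n)) (Set.iUnion_subset fun n => (hD _ _ (hL _)).1) with h | h
  · exact hunb _ (fun n => 2 * n) (fun n => by omega)
      (fun n => Set.subset_iUnion (fun n => E (2 * n)) n) h
  · refine hunb _ (fun n => 2 * n + 1) (fun n => by omega) (fun n => ?_) h
    refine Set.subset_sdiff.2 ⟨(hD (2 * n + 1) (L (2 * n + 1)) (hL (2 * n + 1))).1, Set.disjoint_iUnion_right.2 fun k => ?_⟩
    exact hE (by omega)

lemma bounded_indicatorsIn_univ (hX : IsGExhaustion X) {a b : G} {f : (Fin 2 → G) → G}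
    (hf : IsHomogeneousMonomial f) (hfab : f ![a, b] = b) :
    BoundedFor X (indicatorsIn b Set.univ) := by
  by_contra hb
  obtain ⟨c, hc⟩ := hX.exists_shift_of_isMonomial hf.1
  have hsplit : ∀ J : Set I, ∃ K ⊆ J, ¬ BoundedFor X (indicatorsIn b J) →
      ¬ BoundedFor X (indicatorsIn b K) ∧ ¬ BoundedFor X (indicatorsIn b (J \ K)) := by
    intro J
    by_cases hJ : BoundedFor X (indicatorsIn b J)
    · exact ⟨J, subset_rfl, fun h => (h hJ).elim⟩
    · obtain ⟨K, hKJ, hK⟩ := hX.exists_split hJ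
      exact ⟨K, hKJ, fun _ => hK⟩
  choose s hsub hs using hsplit
  let J : ℕ → Set I := fun n => Nat.rec Set.univ (fun _ S => s S) n
  have hJ : ∀ n, ¬ BoundedFor X (indicatorsIn b (J n)) := by
    intro n
    induction n with
    | zero => exact hb
    | succ n ih => exact (hs _ ih).1
  have hJanti : Antitone J := antitone_nat_of_succ_le fun n => hsub (J n)
  choose m hm using fun n => hX.exists_mem ((J n \ J (n + 1)).mulIndicator fun _ => a)
  have hK : ∀ n, ∃ K ⊆ J n \ J (n + 1), K.mulIndicator (fun _ => b) ∉ X (max (m n) n + c) := by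
    intro n
    by_contra! h
    refine (hs _ (hJ n)).2 ⟨max (m n) n + c, ?_⟩
    rintro _ ⟨K, hKJ, rfl⟩
    exact h K hKJ
  choose K hKJ hK using hK
  obtain ⟨M, hM⟩ := hX.exists_mem ((⋃ n, K n).mulIndicator fun _ => b)
  have hdisj : ∀ i ∈ J M \ J (M + 1), ∀ n, i ∈ K n → n = M := by
    intro i hi n hn
    have hin := hKJ n hn
    rcases lt_trichotomy n M with h | h | h
    · exact (hin.2 (hJanti h hi.1)).elim
    · exact h
    · exact (hi.2 (hJanti h hin.1)).elim
  apply hK M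
  let u : Fin 2 → I → G := ![(J M \ J (M + 1)).mulIndicator fun _ => a,
    (⋃ n, K n).mulIndicator fun _ => b]
  have hu₀ : u 0 = (J M \ J (M + 1)).mulIndicator fun _ => a := rfl
  have hu₁ : u 1 = (⋃ n, K n).mulIndicator fun _ => b := rfl
  have hu : ((K M).mulIndicator fun _ => b) = fun i => f fun j => u j i := by
    funext i
    rcases em (i ∈ J M \ J (M + 1)) with hi | hi
    · by_cases hk : i ∈ K M
      · have hu : i ∈ ⋃ n, K n := Set.mem_iUnion.2 ⟨M, hk⟩
        rw [Set.mulIndicator_of_mem hk]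
        have hv : (fun j => u j i) = ![a, b] := by
          funext j
          fin_cases j
          · change u 0 i = a
            rw [hu₀, Set.mulIndicator_of_mem hi]
          · change u 1 i = b
            rw [hu₁, Set.mulIndicator_of_mem hu]
        rw [hv, hfab]
      · have hu : i ∉ ⋃ n, K n := fun h => by
          obtain ⟨n, hn⟩ := Set.mem_iUnion.1 h
          exact hk (hdisj i hi n hn ▸ hn)
        rw [Set.mulIndicator_of_notMem hk]
        exact (hf.2 _ ⟨1, by rw [hu₁, Set.mulIndicator_of_notMem hu]⟩).symm
    · rw [Set.mulIndicator_of_notMem fun h => hi (hKJ M h)]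
      exact (hf.2 _ ⟨0, by rw [hu₀, Set.mulIndicator_of_notMem hi]⟩).symm
  rw [hu]
  refine hc _ u fun j => ?_
  fin_cases j
  · exact hX.mono (le_max_left _ _) (hm M)
  · exact hX.mono (le_max_right _ _) hM

lemma bounded_indicatorsIn_of_mem_normalClosure (hX : IsGExhaustion X) {b x : G}
    (hb : BoundedFor X (indicatorsIn b Set.univ)) (hx : x ∈ Subgroup.normalClosure {b}) :
    BoundedFor X (indicatorsIn x Set.univ) := by
  induction hx using Subgroup.closure_induction with
  | mem x hx =>
    obtain ⟨_, rfl, h⟩ := Group.mem_conjugatesOfSet_iff.1 hx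
    obtain ⟨g, rfl⟩ := isConj_iff.1 h
    refine (hX.bounded_mul (hX.bounded_mul (hX.bounded_singleton fun _ => g) hb)
      (hX.bounded_singleton fun _ => g⁻¹)).subset ?_
    rintro _ ⟨K, hK, rfl⟩
    refine ⟨_, ⟨_, rfl, _, ⟨K, hK, rfl⟩, rfl⟩, _, rfl, ?_⟩
    funext i
    by_cases hi : i ∈ K <;> simp [Set.mulIndicator, hi]
  | one =>
    refine (hX.bounded_singleton 1).subset ?_
    rintro _ ⟨K, hK, rfl⟩
    exact Set.mulIndicator_one G K
  | mul x y _ _ hx hy =>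
    refine (hX.bounded_mul hx hy).subset ?_
    rintro _ ⟨K, hK, rfl⟩
    exact ⟨_, ⟨K, hK, rfl⟩, _, ⟨K, hK, rfl⟩, (Set.mulIndicator_mul' _ _ _).symm⟩
  | inv x _ hx =>
    refine (hX.bounded_inv hx).subset ?_
    rintro _ ⟨K, hK, rfl⟩
    exact Set.mem_inv.2 ⟨K, hK, by
      rw [inv_eq_iff_eq_inv, ← Set.mulIndicator_inv']
      rfl⟩

lemma bounded_pi_of_finite (hX : IsGExhaustion X) {S : Set G} (hS : S.Finite)
    (h : ∀ x ∈ S, BoundedFor X (indicatorsIn x Set.univ)) :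
    BoundedFor X {u | ∀ i, u i = 1 ∨ u i ∈ S} := by
  induction S, hS using Set.Finite.induction_on with
  | empty =>
    refine (hX.bounded_singleton 1).subset fun u hu => ?_
    funext i
    simpa using hu i
  | @insert x S _ _ ih =>
    refine (hX.bounded_mul (h x (Set.mem_insert x S))
      (ih fun y hy => h y (Set.mem_insert_of_mem x hy))).subset fun u hu => ?_
    refine ⟨_, ⟨{i | u i = x}, Set.subset_univ _, rfl⟩, {i | u i = x}ᶜ.mulIndicator u, ?_, ?_⟩
    · intro i
      by_cases hi : u i = x
      · left; simp [Set.mulIndicator, hi]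
      · rw [Set.mulIndicator_of_mem (by simpa using hi)]
        exact (hu i).imp_right fun h => h.resolve_left hi
    · funext i
      by_cases hi : u i = x <;> simp [Set.mulIndicator, hi]

end IsGExhaustion

/-- Let `G` be a finite group, `I` a set and `H = G^I`. Suppose `f(a, b) = b` for some
`a, b ∈ G` and some homogeneous monomial `f : G² → G`, and let `N` be the normal subgroup
of `G` generated by `b`. If `(X m)` is an increasing sequence of subsets of `H` with
`GSet (X m) ⊆ X (m+1)` for all `m` and `⋃ m, X m = H`, then `N^I ⊆ X m` for all
sufficiently large `m`. -/
theorem normalClosure_pow_subset_of_exhaustion (G : Type) [Group G] [Finite G]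
    (I : Type) (a b : G) (f : (Fin 2 → G) → G)
    (hf : IsHomogeneousMonomial f) (hfab : f ![a, b] = b)
    (X : ℕ → Set (I → G)) (hmono : Monotone X)
    (hG : ∀ m, GSet (X m) ⊆ X (m + 1)) (hexh : (⋃ m, X m) = Set.univ) :
    ∃ M, ∀ m ≥ M, {h : I → G | ∀ i, h i ∈ Subgroup.normalClosure {b}} ⊆ X m := by
  have hX : IsGExhaustion X :=
    ⟨hmono, hG, fun h => Set.mem_iUnion.1 (hexh ▸ Set.mem_univ h)⟩
  obtain ⟨M, hM⟩ := hX.bounded_pi_of_finite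
    (Set.toFinite (Subgroup.normalClosure {b} : Set G)) fun x hx =>
      hX.bounded_indicatorsIn_of_mem_normalClosure (hX.bounded_indicatorsIn_univ hf hfab) hx
  exact ⟨M, fun m hm h hh => hmono hm (hM fun i => Or.inr (hh i))⟩
end

section
/- Let G be a nilpotent group, let f : G² → G be a homogeneous monomial, and let a, b ∈ G satisfy f(a, b) = b. Then b = 1. -/
/-- If the image of `b` under a homomorphism `π` is central, then, modulo the kernel of `π`,
replacing the second argument `1` of a monomial by `b` multiplies its value by a central
element that does not depend on the first argument. -/
theorem IsMonomial.exists_center_map_eq {G H : Type} [Group G] [Group H]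
    {f : (Fin 2 → G) → G} (hf : IsMonomial f) (π : G →* H) {b : G}
    (hb : π b ∈ Subgroup.center H) :
    ∃ c ∈ Subgroup.center H, ∀ x : G, π (f ![x, b]) = π (f ![x, 1]) * c := by
  induction hf using Subgroup.closure_induction with
  | mem f hf =>
    rcases hf with ⟨g, rfl⟩ | ⟨i, rfl⟩
    · exact ⟨1, one_mem _, by simp⟩
    · fin_cases i
      · exact ⟨1, one_mem _, by simp⟩
      · exact ⟨π b, hb, by simp⟩
  | one => exact ⟨1, one_mem _, by simp⟩
  | mul f g _ _ hf hg =>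
    obtain ⟨c, hc, hfc⟩ := hf
    obtain ⟨d, hd, hgd⟩ := hg
    refine ⟨c * d, mul_mem hc hd, fun x => ?_⟩
    have hcomm := Subgroup.mem_center_iff.mp hc (π (g ![x, 1]))
    simp only [Pi.mul_apply, map_mul, hfc, hgd, mul_assoc]
    rw [← mul_assoc c, ← hcomm, mul_assoc]
  | inv f _ hf =>
    obtain ⟨c, hc, hfc⟩ := hf
    refine ⟨c⁻¹, inv_mem hc, fun x => ?_⟩
    have hcomm := Subgroup.mem_center_iff.mp (inv_mem hc) (π (f ![x, 1]))⁻¹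
    simp only [Pi.inv_apply, map_inv, hfc, mul_inv_rev, hcomm]

/-- A homogeneous monomial in two variables is trivial modulo the kernel of a homomorphism
that maps the second argument into the center. -/
theorem IsHomogeneousMonomial.map_eq_one {G H : Type} [Group G] [Group H]
    {f : (Fin 2 → G) → G} (hf : IsHomogeneousMonomial f) (π : G →* H) {b : G}
    (hb : π b ∈ Subgroup.center H) (a : G) : π (f ![a, b]) = 1 := by
  obtain ⟨c, -, hc⟩ := hf.1.exists_center_map_eq π hb
  have hone (x : G) : f ![x, 1] = 1 := hf.2 _ ⟨1, by simp⟩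
  have hc_one : c = 1 := by
    simpa [hone, hf.2 ![1, b] ⟨0, by simp⟩] using (hc 1).symm
  rw [hc a, hone, hc_one, map_one, one_mul]

/-- In a nilpotent group, if `f(a, b) = b` for a homogeneous monomial `f : G² → G`,
then `b = 1`. -/
theorem eq_one_of_homogeneous_monomial_fixed_point (G : Type) [Group G]
    [Group.IsNilpotent G] (f : (Fin 2 → G) → G) (hf : IsHomogeneousMonomial f)
    (a b : G) (hfab : f ![a, b] = b) : b = 1 := by
  have hmem (n : ℕ) : b ∈ (⊤ : Subgroup G).lowerCentralSeries n := by
    induction n with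
    | zero => simp
    | succ n ih =>
      rw [← QuotientGroup.eq_one_iff, ← hfab]
      refine hf.map_eq_one (QuotientGroup.mk' _) (Subgroup.mem_center_iff.mpr fun q => ?_) a
      obtain ⟨g, rfl⟩ := QuotientGroup.mk'_surjective _ q
      rw [← map_mul, ← map_mul, eq_comm, ← mul_inv_eq_one, ← map_inv, ← map_mul]
      refine (QuotientGroup.eq_one_iff _).mpr ?_
      have h := Subgroup.commutator_mem_commutator ih (Subgroup.mem_top g)
      simpa [commutatorElement_def, mul_assoc] using h
  obtain ⟨n, hn⟩ := Subgroup.nilpotent_iff_lowerCentralSeries.mp ‹Group.IsNilpotent G›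
  simpa [hn] using hmem n
end

section
/- Let G be a group such that every countable subset of G is contained in a subgroup H of G with the property that every action of H by isometries on a real Hilbert space has bounded orbits. Then every action of G by isometries on a real Hilbert space has bounded orbits. -/
/-- A group `H` has bounded orbits for all of its isometric actions on real Hilbert
spaces. -/
def HilbertBoundedOrbits (H : Type) [Group H] : Prop :=
  ∀ (V : Type) [NormedAddCommGroup V] [InnerProductSpace ℝ V] [CompleteSpace V]
    (φ : H →* (V ≃ᵢ V)) (v : V),
    Bornology.IsBounded (Set.range fun h : H => φ h v)

/-- If every countable subset of `G` is contained in a subgroup all of whose isometric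
actions on real Hilbert spaces have bounded orbits, then every isometric action of `G`
on a real Hilbert space has bounded orbits. -/
theorem hilbertBoundedOrbits_of_countable_subsets (G : Type) [Group G]
    (h : ∀ S : Set G, S.Countable →
      ∃ H : Subgroup G, S ⊆ (H : Set G) ∧ HilbertBoundedOrbits H) :
    HilbertBoundedOrbits G := by
  intro V _ _ _ φ v
  by_contra hb
  have hfar : ∀ n : ℕ, ∃ g : G, (n : ℝ) < dist (φ g v) v := by
    by_contra! hn
    obtain ⟨n, hn⟩ := hn
    refine hb ((Metric.isBounded_iff_subset_closedBall v).2 ⟨n, ?_⟩)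
    rintro _ ⟨g, rfl⟩
    exact hn g
  choose g hg using hfar
  obtain ⟨H, hgH, hH⟩ := h (Set.range g) (Set.countable_range g)
  obtain ⟨r, hr⟩ := (Metric.isBounded_iff_subset_closedBall v).1
    (hH V (φ.comp H.subtype) v)
  obtain ⟨n, hn⟩ := exists_nat_gt r
  have hle : dist (φ (g n) v) v ≤ r := hr ⟨⟨g n, hgH ⟨n, rfl⟩⟩, rfl⟩
  linarith [hg n]
end
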